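/- arXiv:1812.07725 — 4 statements merged into one kernel-verified Lean document; each statement's English description precedes it below -/
import Mathlib

section
/- Assume the ULD setting with 0 < γ < 2√m, and fix δ ∈ (0,1), r > 0, 𝒯 > 0. Set ε̂ := 1 − γ/(2√m) and C_ε̂ := (1+M)/√(m(1−(1−ε̂)²)). Suppose 0 < ε < min{√m(1−ε̂)/(4C_ε̂·L·(1+1/(64C_ε̂²))), 8rC_ε̂}. Let 𝒯_rec := (2/(√m(1−ε̂)))·log(8rC_ε̂/ε) and 𝒯_esc := 𝒯_rec + 𝒯. Assume η ≤ min{1, ε·e^{−(1+γ+M)}/(8B), δε²e^{−2(1+γ+M)}/(384(M²C_x^c+(1+γ)²C_v^c)·𝒯_rec), 4γδ²/(9βM²C_v^d·𝒯_esc), γ(d+Ā)/(K₂β), γλ/(2K₁)} and β ≥ max{(128γC_ε̂²/(√m(1−ε̂)ε²))·(d·log 2 + log((6√(γ²+M²+1)·𝒯+3)/δ)), 512dγη·log(2^{1/4}e^{1/4}·6𝒯_rec/(δη))/(ε²·e^{−2(1+γ+M)η})}. Then with probability at least 1−δ with respect to the Gaussian noise, at least one of the following occurs: (1) ‖X_k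 − x_*‖ ≥ (1/2)(ε + r·e^{−√m(1−ε̂)kη}) for some integer k ≤ η^{−1}𝒯_rec; (2) ‖X_k − x_*‖ ≤ ε + r·e^{−√m(1−ε̂)kη} for every integer k with η^{−1}𝒯_rec ≤ k ≤ η^{−1}𝒯_esc. -/
open MeasureTheory ProbabilityTheory Matrix
open scoped RealInnerProductSpace ENNReal NNReal
open Gradient

noncomputable section

/-- The standard Gaussian measure on `EuclideanSpace ℝ (Fin d)`. -/
def stdGaussianE (d : ℕ) : Measure (EuclideanSpace ℝ (Fin d)) :=
  (Measure.pi fun _ : Fin d => gaussianReal 0 1).map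
    (MeasurableEquiv.toLp 2 (Fin d → ℝ))

/-- One-dimensional Gaussian integral of the exponential of a square. -/
lemma uld_gauss_one (a s u : ℝ) (hu : 2 * s ^ 2 < u) :
    ∫⁻ x, ENNReal.ofReal (Real.exp ((a + s * x) ^ 2 / u)) ∂(gaussianReal 0 1) =
      ENNReal.ofReal (Real.sqrt (u / (u - 2 * s ^ 2)) * Real.exp (a ^ 2 / (u - 2 * s ^ 2))) := by
  have hu0 : 0 < u := lt_of_le_of_lt (by positivity) hu
  have hw : 0 < u - 2 * s ^ 2 := by linarith
  set w := u - 2 * s ^ 2 with hwdef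
  have hv : 0 < u / w := by positivity
  obtain ⟨v, hvv⟩ : ∃ v : ℝ≥0, (v : ℝ) = u / w := ⟨⟨u / w, hv.le⟩, rfl⟩
  have hv0 : v ≠ 0 := by
    intro h
    rw [h, NNReal.coe_zero] at hvv
    exact absurd hvv hv.ne
  rw [gaussianReal_of_var_ne_zero 0 one_ne_zero,
    lintegral_withDensity_eq_lintegral_mul _ (measurable_gaussianPDF 0 1)
      (by fun_prop)]
  have key : ∀ x : ℝ, (gaussianPDF 0 1 * fun x => ENNReal.ofReal (Real.exp ((a + s * x) ^ 2 / u))) x =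
      ENNReal.ofReal (Real.sqrt (u / w) * Real.exp (a ^ 2 / w)) *
        gaussianPDF (2 * a * s / w) v x := by
    intro x
    simp only [Pi.mul_apply, gaussianPDF]
    rw [← ENNReal.ofReal_mul (gaussianPDFReal_nonneg _ _ _), ← ENNReal.ofReal_mul (by positivity)]
    congr 1
    simp only [gaussianPDFReal, hvv, NNReal.coe_one]
    have h1 : Real.sqrt (2 * Real.pi * (u / w)) = Real.sqrt (2 * Real.pi * 1) * Real.sqrt (u / w) := by
      rw [mul_one, Real.sqrt_mul (by positivity)]
    have hs0 : Real.sqrt (u / w) ≠ 0 := by positivity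
    have hp0 : Real.sqrt (2 * Real.pi * 1) ≠ 0 := by positivity
    rw [h1]
    have h2 : Real.exp (-(x - 0) ^ 2 / (2 * 1)) * Real.exp ((a + s * x) ^ 2 / u) =
        Real.exp (a ^ 2 / w) * Real.exp (-(x - 2 * a * s / w) ^ 2 / (2 * (u / w))) := by
      rw [← Real.exp_add, ← Real.exp_add]
      congr 1
      have : u = w + 2 * s ^ 2 := by rw [hwdef]; ring
      field_simp
      rw [this]; ring
    rw [mul_assoc, h2]
    field_simp
  simp_rw [key]
  rw [lintegral_const_mul _ (measurable_gaussianPDF _ _), lintegral_gaussianPDF_eq_one _ hv0, mul_one]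

/-- `d`-dimensional version. -/
lemma uld_gauss_vec {d : ℕ} (p : EuclideanSpace ℝ (Fin d)) (s u : ℝ) (hu : 2 * s ^ 2 < u) :
    ∫⁻ x, ENNReal.ofReal (Real.exp (‖p + s • x‖ ^ 2 / u)) ∂(stdGaussianE d) =
      ENNReal.ofReal (Real.sqrt (u / (u - 2 * s ^ 2)) ^ d *
        Real.exp (‖p‖ ^ 2 / (u - 2 * s ^ 2))) := by
  have hw : 0 < u - 2 * s ^ 2 := by linarith
  unfold stdGaussianE
  rw [lintegral_map (by fun_prop) (by fun_prop)]
  have h1 : ∀ x : Fin d → ℝ, ENNReal.ofReal (Real.exp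
      (‖p + s • (MeasurableEquiv.toLp 2 (Fin d → ℝ)) x‖ ^ 2 / u)) =
      ∏ i, ENNReal.ofReal (Real.exp ((p i + s * x i) ^ 2 / u)) := by
    intro x
    rw [← ENNReal.ofReal_prod_of_nonneg (fun i _ => (Real.exp_pos _).le), ← Real.exp_sum,
      EuclideanSpace.norm_sq_eq, ← Finset.sum_div]
    simp
  simp_rw [h1]
  have h2 := iIndepFun_pi (μ := fun _ : Fin d => gaussianReal 0 1)
    (X := fun i (x : ℝ) => ENNReal.ofReal (Real.exp ((p i + s * x) ^ 2 / u)))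
    (fun i => by fun_prop)
  have h3 := lintegral_prod_eq_prod_lintegral_of_indepFun Finset.univ
    (fun i (x : Fin d → ℝ) => ENNReal.ofReal (Real.exp ((p i + s * x i) ^ 2 / u))) h2
    (fun i => by fun_prop)
  rw [h3]
  have h4 : ∀ i : Fin d, ∫⁻ x : Fin d → ℝ, ENNReal.ofReal (Real.exp ((p i + s * x i) ^ 2 / u))
      ∂(Measure.pi fun _ : Fin d => gaussianReal 0 1) =
      ENNReal.ofReal (Real.sqrt (u / (u - 2 * s ^ 2)) *
        Real.exp (p i ^ 2 / (u - 2 * s ^ 2))) := by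
    intro i
    rw [← uld_gauss_one (p i) s u hu]
    have hmp := measurePreserving_eval (fun _ : Fin d => gaussianReal 0 1) i
    rw [← hmp.lintegral_comp (f := fun x => ENNReal.ofReal (Real.exp ((p i + s * x) ^ 2 / u)))
      (by fun_prop)]
  simp_rw [h4]
  rw [← ENNReal.ofReal_prod_of_nonneg (fun i _ => by positivity), Finset.prod_mul_distrib,
    ← Real.exp_sum, EuclideanSpace.norm_sq_eq, ← Finset.sum_div]
  simp

/-- Integrating out an independent variable. -/
lemma uld_indep_lintegral {Ω : Type*} (𝓕 : MeasurableSpace Ω) [mΩ : MeasurableSpace Ω]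
    (P : Measure Ω) [IsProbabilityMeasure P] {E : Type*} [MeasurableSpace E] {G : Type*} [MeasurableSpace G]
    (h𝓕 : 𝓕 ≤ mΩ) (ξ : Ω → E) (hξ : Measurable ξ)
    (hind : Indep 𝓕 (MeasurableSpace.comap ξ inferInstance) P)
    (φ : Ω → ℝ≥0∞) (hφ : Measurable[𝓕] φ) (p : Ω → G) (hp : Measurable[𝓕] p)
    (g : G → E → ℝ≥0∞) (hg : Measurable (Function.uncurry g)) :
    ∫⁻ ω, φ ω * g (p ω) (ξ ω) ∂P = ∫⁻ ω, φ ω * ∫⁻ x, g (p ω) x ∂(P.map ξ) ∂P := by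
  have hφ' : Measurable φ := hφ.mono h𝓕 le_rfl
  have hp' : Measurable p := hp.mono h𝓕 le_rfl
  have hZ : Measurable[𝓕] (fun ω => (φ ω, p ω)) := hφ.prodMk hp
  have hZ' : Measurable (fun ω => (φ ω, p ω)) := hφ'.prodMk hp'
  have hif : IndepFun (fun ω => (φ ω, p ω)) ξ P := by
    rw [IndepFun_iff_Indep]
    exact indep_of_indep_of_le_left hind hZ.comap_le
  have hmap := (indepFun_iff_map_prod_eq_prod_map_map hZ'.aemeasurable hξ.aemeasurable).1 hif
  have : IsProbabilityMeasure (P.map ξ) := Measure.isProbabilityMeasure_map hξ.aemeasurable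
  have : IsProbabilityMeasure (P.map (fun ω => (φ ω, p ω))) :=
    Measure.isProbabilityMeasure_map hZ'.aemeasurable
  have hg1 : Measurable (fun z : (ℝ≥0∞ × G) × E => z.1.1 * g z.1.2 z.2) := by
    refine (measurable_fst.comp measurable_fst).mul ?_
    exact hg.comp ((measurable_snd.comp measurable_fst).prodMk measurable_snd)
  have e1 : ∫⁻ ω, φ ω * g (p ω) (ξ ω) ∂P =
      ∫⁻ z, z.1.1 * g z.1.2 z.2 ∂(P.map (fun ω => ((φ ω, p ω), ξ ω))) := by
    rw [lintegral_map hg1 (hZ'.prodMk hξ)]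
  rw [e1, hmap, lintegral_prod _ hg1.aemeasurable]
  rw [lintegral_map (hg1.lintegral_prod_right') hZ']
  refine lintegral_congr fun ω => ?_
  rw [lintegral_const_mul]
  exact hg.comp (measurable_const.prodMk measurable_id)

/-- Maximal inequality for nonnegative supermartingales (hands-on version). -/
lemma uld_maximal {Ω : Type*} [mΩ : MeasurableSpace Ω] (P : Measure Ω)
    (𝓕 : ℕ → MeasurableSpace Ω) (h𝓕 : ∀ k, 𝓕 k ≤ mΩ) (hmono : ∀ k, 𝓕 k ≤ 𝓕 (k + 1))
    (S : ℕ → Ω → ℝ≥0∞) (hS : ∀ k, Measurable[𝓕 k] (S k))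
    (hsup : ∀ k (φ : Ω → ℝ≥0∞), Measurable[𝓕 k] φ →
      ∫⁻ ω, φ ω * S (k + 1) ω ∂P ≤ ∫⁻ ω, φ ω * S k ω ∂P) (lam : ℝ≥0∞) (n : ℕ) :
    lam * P {ω | ∃ k ≤ n, lam ≤ S k ω} ≤ ∫⁻ ω, S 0 ω ∂P := by
  have hm : ∀ i j, i ≤ j → 𝓕 i ≤ 𝓕 j := fun i j hij => monotone_nat_of_le_succ hmono hij
  let A : ℕ → Set Ω := fun n => {ω | ∃ k ≤ n, lam ≤ S k ω}
  have hA : ∀ n, MeasurableSet[𝓕 n] (A n) := by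
    intro n
    have : A n = ⋃ k ∈ Set.Iic n, {ω | lam ≤ S k ω} := by
      ext ω; simp [A]
    rw [this]
    refine MeasurableSet.biUnion (Set.to_countable _) fun k hk => ?_
    exact hm k n hk _ ((hS k) measurableSet_Ici)
  have hA' : ∀ n, MeasurableSet (A n) := fun n => h𝓕 n _ (hA n)
  have main : ∀ n, lam * P (A n) + ∫⁻ ω, (A n)ᶜ.indicator 1 ω * S n ω ∂P ≤ ∫⁻ ω, S 0 ω ∂P := by
    intro n
    induction n with
    | zero =>
      have e : lam * P (A 0) = ∫⁻ ω, (A 0).indicator (fun _ => lam) ω ∂P := by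
        rw [lintegral_indicator (hA' 0)]; simp
      rw [e, ← lintegral_add_left (measurable_const.indicator (hA' 0))]
      refine lintegral_mono fun ω => ?_
      by_cases hω : ω ∈ A 0
      · have : lam ≤ S 0 ω := by
          obtain ⟨k, hk, h⟩ := hω
          have : k = 0 := by omega
          rwa [this] at h
        simpa [hω] using this
      · simp [hω]
    | succ n ih =>
      refine le_trans ?_ ih
      have hsub : A n ⊆ A (n + 1) := fun ω ⟨k, hk, h⟩ => ⟨k, by omega, h⟩
      have e : P (A (n + 1)) = P (A n) + P (A (n + 1) \ A n) := by
        rw [measure_add_sdiff (hA' n).nullMeasurableSet, Set.union_eq_self_of_subset_left hsub]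
      rw [e, mul_add, add_assoc]
      gcongr
      have hφ : Measurable[𝓕 n] ((A n)ᶜ.indicator (1 : Ω → ℝ≥0∞)) :=
        measurable_const.indicator (hA n).compl
      refine le_trans ?_ (hsup n _ hφ)
      have hD : MeasurableSet (A (n + 1) \ A n) := (hA' (n + 1)).diff (hA' n)
      have e : lam * P (A (n + 1) \ A n) =
          ∫⁻ ω, (A (n + 1) \ A n).indicator (fun _ => lam) ω ∂P := by
        rw [lintegral_indicator hD]; simp
      rw [e, ← lintegral_add_left (measurable_const.indicator hD)]
      refine lintegral_mono fun ω => ?_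
      by_cases h1 : ω ∈ A n
      · have h2 := hsub h1
        simp [h1, h2]
      · by_cases h2 : ω ∈ A (n + 1)
        · have : lam ≤ S (n + 1) ω := by
            obtain ⟨k, hk, h⟩ := h2
            have : k = n + 1 := by
              by_contra hne
              exact h1 ⟨k, by omega, h⟩
            rwa [this] at h
          simpa [h1, h2] using this
        · simp [h1, h2]
  exact le_trans le_self_add (main n)

section Energy

variable {E : Type*} [NormedAddCommGroup E] [InnerProductSpace ℝ E]

/-- Energy adapted to the linearised underdamped dynamics. -/
def uldQ (H : E →L[ℝ] E) (γ : ℝ) (v y : E) : ℝ :=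
  ‖v + (γ / 2) • y‖ ^ 2 + (⟪y, H y⟫ - γ ^ 2 / 4 * ‖y‖ ^ 2)

lemma uldQ_lower (H : E →L[ℝ] E) (γ m : ℝ) (hlow : ∀ y, m * ‖y‖ ^ 2 ≤ ⟪y, H y⟫) (v y : E) :
    (m - γ ^ 2 / 4) * ‖y‖ ^ 2 ≤ uldQ H γ v y := by
  unfold uldQ
  nlinarith [hlow y, sq_nonneg ‖v + (γ / 2) • y‖]

lemma uldQ_nonneg (H : E →L[ℝ] E) (γ m : ℝ) (hlow : ∀ y, m * ‖y‖ ^ 2 ≤ ⟪y, H y⟫)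
    (hγ : γ ^ 2 / 4 < m) (v y : E) : 0 ≤ uldQ H γ v y :=
  le_trans (mul_nonneg (by linarith) (sq_nonneg _)) (uldQ_lower H γ m hlow v y)

lemma uldQ_step (H : E →L[ℝ] E) (γ m M η : ℝ) (hsym : ∀ x y, ⟪H x, y⟫ = ⟪x, H y⟫)
    (hlow : ∀ y, m * ‖y‖ ^ 2 ≤ ⟪y, H y⟫) (hup : ∀ y, ⟪y, H y⟫ ≤ M * ‖y‖ ^ 2)
    (hγ : γ ^ 2 / 4 < m) (hmM : m ≤ M) (v y : E) :
    uldQ H γ (v - η • (γ • v + H y)) (y + η • v) ≤ (1 - η * γ + η ^ 2 * M) * uldQ H γ v y := by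
  obtain ⟨K, hK⟩ : ∃ K : E →L[ℝ] E, ∀ x, H x = K x + (γ ^ 2 / 4) • x :=
    ⟨H - (γ ^ 2 / 4) • ContinuousLinearMap.id ℝ E, fun x => by simp⟩
  have hq : ∀ v y, uldQ H γ v y = ‖v + (γ / 2) • y‖ ^ 2 + ⟪y, K y⟫ := by
    intro v y
    unfold uldQ
    rw [hK, inner_add_right, real_inner_smul_right, real_inner_self_eq_norm_sq]
    ring
  have hKsym : ∀ x y, ⟪K x, y⟫ = ⟪x, K y⟫ := by
    intro x y
    have := hsym x y
    rw [hK, hK, inner_add_right, inner_add_left, real_inner_smul_right, real_inner_smul_left] at this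
    linarith
  have hKlow : ∀ y, 0 ≤ ⟪y, K y⟫ := by
    intro y
    have := hlow y
    rw [hK, inner_add_right, real_inner_smul_right, real_inner_self_eq_norm_sq] at this
    nlinarith [sq_nonneg ‖y‖]
  have hKup : ∀ y, ⟪y, K y⟫ ≤ (M - γ ^ 2 / 4) * ‖y‖ ^ 2 := by
    intro y
    have := hup y
    rw [hK, inner_add_right, real_inner_smul_right, real_inner_self_eq_norm_sq] at this
    nlinarith [sq_nonneg ‖y‖]
  obtain ⟨κ, hκ⟩ : ∃ κ, κ = M - γ ^ 2 / 4 := ⟨_, rfl⟩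
  have hκ0 : 0 < κ := by linarith
  have hKK : ‖K y‖ ^ 2 ≤ κ * ⟪y, K y⟫ := by
    have h1 := hKlow (y - κ⁻¹ • K y)
    rw [map_sub, map_smul, inner_sub_left, inner_sub_right, inner_sub_right,
      real_inner_smul_left, real_inner_smul_right, real_inner_smul_right, real_inner_smul_left,
      ← hKsym y (K y), real_inner_self_eq_norm_sq] at h1
    have h2 := hKup (K y)
    rw [← hκ] at h2
    have h3 : κ⁻¹ * (κ⁻¹ * ⟪K y, K (K y)⟫) ≤ κ⁻¹ * (κ⁻¹ * (κ * ‖K y‖ ^ 2)) := by gcongr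
    have h4 : κ⁻¹ * (κ⁻¹ * (κ * ‖K y‖ ^ 2)) = κ⁻¹ * ‖K y‖ ^ 2 := by field_simp
    have h5 : κ⁻¹ * ‖K y‖ ^ 2 ≤ ⟪y, K y⟫ := by linarith
    rw [inv_mul_le_iff₀ hκ0] at h5
    exact h5
  rw [hq, hq]
  obtain ⟨p, hp⟩ : ∃ p, p = v + (γ / 2) • y := ⟨_, rfl⟩
  have hv : v = p - (γ / 2) • y := by rw [hp]; module
  have e1 : v - η • (γ • v + H y) + (γ / 2) • (y + η • v) = (1 - η * γ / 2) • p - η • K y := by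
    rw [hK, hv]; module
  have e2 : y + η • v = (1 - η * γ / 2) • y + η • p := by
    rw [hv]; module
  rw [e1, ← hp, e2, norm_sub_sq_real, norm_smul, norm_smul, map_add, map_smul, map_smul,
    inner_add_left, inner_add_right, inner_add_right]
  simp only [real_inner_smul_left, real_inner_smul_right, mul_pow, Real.norm_eq_abs, sq_abs]
  have h7 := hKup p
  rw [← hKsym y p, real_inner_comm p (K y)]
  have h8 := mul_nonneg (sq_nonneg η) (sub_nonneg.2 hKK)
  have h9 := mul_nonneg (sq_nonneg η) (sub_nonneg.2 h7)
  rw [hκ] at h8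
  nlinarith [h8, h9]

lemma uldQ_add (H : E →L[ℝ] E) (γ m : ℝ) (hlow : ∀ y, m * ‖y‖ ^ 2 ≤ ⟪y, H y⟫)
    (hγ : γ ^ 2 / 4 < m) (v y u : E) :
    Real.sqrt (uldQ H γ (v + u) y) ≤ Real.sqrt (uldQ H γ v y) + ‖u‖ := by
  have hs : 0 ≤ ⟪y, H y⟫ - γ ^ 2 / 4 * ‖y‖ ^ 2 := by nlinarith [hlow y, sq_nonneg ‖y‖]
  have h0 := uldQ_nonneg H γ m hlow hγ v y
  have hsq := Real.sq_sqrt h0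
  have hs0 := Real.sqrt_nonneg (uldQ H γ v y)
  apply Real.sqrt_le_iff.2
  refine ⟨by positivity, ?_⟩
  have h1 : ‖v + u + (γ / 2) • y‖ ≤ ‖v + (γ / 2) • y‖ + ‖u‖ := by
    have : v + u + (γ / 2) • y = (v + (γ / 2) • y) + u := by abel
    rw [this]; exact norm_add_le _ _
  have h2 : ‖v + (γ / 2) • y‖ ≤ Real.sqrt (uldQ H γ v y) := by
    apply Real.le_sqrt_of_sq_le
    unfold uldQ; linarith
  have h3 : ‖v + u + (γ / 2) • y‖ ^ 2 ≤ (‖v + (γ / 2) • y‖ + ‖u‖) ^ 2 := by gcongr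
  rw [add_sq, hsq]
  have h4 := mul_le_mul_of_nonneg_right h2 (norm_nonneg u)
  unfold uldQ at *
  nlinarith [h3, h4]

end Energy

section Noise

variable {Ω : Type*} {d : ℕ}

/-- The noise part (velocity, position) of the linearised dynamics. -/
def uldG (H : EuclideanSpace ℝ (Fin d) →L[ℝ] EuclideanSpace ℝ (Fin d)) (γ η σ : ℝ)
    (ξ : ℕ → Ω → EuclideanSpace ℝ (Fin d)) :
    ℕ → Ω → EuclideanSpace ℝ (Fin d) × EuclideanSpace ℝ (Fin d)
  | 0 => fun _ => (0, 0)
  | k + 1 => fun ω =>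
      ((uldG H γ η σ ξ k ω).1 - η • (γ • (uldG H γ η σ ξ k ω).1 + H (uldG H γ η σ ξ k ω).2)
          + σ • ξ k ω,
        (uldG H γ η σ ξ k ω).2 + η • (uldG H γ η σ ξ k ω).1)

/-- The filtration generated by the noise. -/
def uldFil (ξ : ℕ → Ω → EuclideanSpace ℝ (Fin d)) (k : ℕ) : MeasurableSpace Ω :=
  ⨆ i ∈ Set.Iio k, MeasurableSpace.comap (ξ i) inferInstance

lemma uldFil_mono (ξ : ℕ → Ω → EuclideanSpace ℝ (Fin d)) (k : ℕ) :
    uldFil ξ k ≤ uldFil ξ (k + 1) :=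
  biSup_mono fun i hi => by
    simp only [Set.mem_Iio] at hi ⊢
    omega

lemma uldFil_meas (ξ : ℕ → Ω → EuclideanSpace ℝ (Fin d)) (k : ℕ) :
    Measurable[uldFil ξ (k + 1)] (ξ k) := by
  have h : MeasurableSpace.comap (ξ k) inferInstance ≤ uldFil ξ (k + 1) :=
    le_biSup (fun i => MeasurableSpace.comap (ξ i) inferInstance) (Set.mem_Iio.2 (Nat.lt_succ_self k))
  exact (comap_measurable (ξ k)).mono h le_rfl

lemma uldG_meas (H : EuclideanSpace ℝ (Fin d) →L[ℝ] EuclideanSpace ℝ (Fin d)) (γ η σ : ℝ)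
    (ξ : ℕ → Ω → EuclideanSpace ℝ (Fin d)) (k : ℕ) :
    Measurable[uldFil ξ k] (fun ω => (uldG H γ η σ ξ k ω).1) ∧
      Measurable[uldFil ξ k] (fun ω => (uldG H γ η σ ξ k ω).2) := by
  induction k with
  | zero => exact ⟨measurable_const, measurable_const⟩
  | succ k ih =>
    have h1 := ih.1.mono (uldFil_mono ξ k) le_rfl
    have h2 := ih.2.mono (uldFil_mono ξ k) le_rfl
    have h3 := uldFil_meas ξ k
    constructor
    · exact (h1.sub (((h1.const_smul γ).add (H.continuous.measurable.comp h2)).const_smul η)).add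
        (h3.const_smul σ)
    · exact h2.add (h1.const_smul η)

lemma uldQ_cont (H : EuclideanSpace ℝ (Fin d) →L[ℝ] EuclideanSpace ℝ (Fin d)) (γ : ℝ) :
    Continuous (fun z : EuclideanSpace ℝ (Fin d) × EuclideanSpace ℝ (Fin d) => uldQ H γ z.1 z.2) := by
  unfold uldQ
  fun_prop

/-- Supermartingale maximal inequality for a block of times. -/
lemma uld_noise_block [mΩ : MeasurableSpace Ω] (P : Measure Ω) [IsProbabilityMeasure P]
    (H : EuclideanSpace ℝ (Fin d) →L[ℝ] EuclideanSpace ℝ (Fin d)) (γ m η σ Θ : ℝ)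
    (ξ : ℕ → Ω → EuclideanSpace ℝ (Fin d)) (hξmeas : ∀ k, Measurable (ξ k))
    (hξindep : iIndepFun ξ P) (hξ : ∀ k, Measure.map (ξ k) P = stdGaussianE d)
    (hlow : ∀ y, m * ‖y‖ ^ 2 ≤ ⟪y, H y⟫) (hγ : γ ^ 2 / 4 < m) (hΘ : 0 < Θ) (hσ : 0 < σ)
    (hstep : ∀ v y, uldQ H γ (v - η • (γ • v + H y)) (y + η • v) ≤ Θ * uldQ H γ v y)
    (n k0 : ℕ) (D Ex τ : ℝ) (hD0 : 0 < D) (hD : ∑ i ∈ Finset.range n, Θ ^ i ≤ D) (hτ : 0 ≤ τ)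
    (hEx : ∀ k, k0 ≤ k → k ≤ n → Θ ^ k ≤ Ex * Θ ^ n) (hEx0 : 0 < Ex) :
    P {ω | ∃ k, k0 ≤ k ∧ k ≤ n ∧
        τ ≤ uldQ H γ (uldG H γ η σ ξ k ω).1 (uldG H γ η σ ξ k ω).2} ≤
      ENNReal.ofReal (2 ^ d * Real.exp (-(τ / (4 * σ ^ 2 * D * Ex)))) := by
  let w : ℕ → ℝ := fun k => 2 * σ ^ 2 * D / Θ ^ n +
    2 * σ ^ 2 * ∑ j ∈ Finset.range k, (Θ ^ (j + 1))⁻¹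
  have hw0 : w 0 = 2 * σ ^ 2 * D / Θ ^ n := by simp [w]
  have hw0p : 0 < 2 * σ ^ 2 * D / Θ ^ n := by positivity
  have hwp : ∀ k, 0 < w k := fun k => by
    have : 0 ≤ 2 * σ ^ 2 * ∑ j ∈ Finset.range k, (Θ ^ (j + 1))⁻¹ := by positivity
    simp only [w]; linarith
  have hws : ∀ k, w (k + 1) = w k + 2 * σ ^ 2 * (Θ ^ (k + 1))⁻¹ := fun k => by
    simp only [w, Finset.sum_range_succ]; ring
  have hw2 : ∀ k ≤ n, w k ≤ 2 * (2 * σ ^ 2 * D / Θ ^ n) := by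
    intro k hk
    have h1 : ∑ j ∈ Finset.range k, (Θ ^ (j + 1))⁻¹ ≤ ∑ j ∈ Finset.range n, (Θ ^ (j + 1))⁻¹ :=
      Finset.sum_le_sum_of_subset_of_nonneg (by simpa using hk) (fun _ _ _ => by positivity)
    have h2 : ∑ j ∈ Finset.range n, (Θ ^ (j + 1))⁻¹ = (∑ i ∈ Finset.range n, Θ ^ i) / Θ ^ n := by
      rw [← Finset.sum_range_reflect, Finset.sum_div]
      refine Finset.sum_congr rfl fun j hj => ?_
      rw [Finset.mem_range] at hj
      rw [inv_eq_one_div, div_eq_div_iff (by positivity) (by positivity), one_mul, ← pow_add]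
      congr 1; omega
    have h3 : (∑ i ∈ Finset.range n, Θ ^ i) / Θ ^ n ≤ D / Θ ^ n := by gcongr
    have h4 : 2 * σ ^ 2 * ∑ j ∈ Finset.range k, (Θ ^ (j + 1))⁻¹ ≤ 2 * σ ^ 2 * (D / Θ ^ n) := by
      gcongr
      linarith
    have h5 : 2 * σ ^ 2 * (D / Θ ^ n) = 2 * σ ^ 2 * D / Θ ^ n := by ring
    simp only [w]; linarith
  let u : ℕ → ℝ := fun k => Θ ^ k * w k
  have hup : ∀ k, 0 < u k := fun k => mul_pos (by positivity) (hwp k)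
  have hus : ∀ k, u (k + 1) = Θ * u k + 2 * σ ^ 2 := fun k => by
    simp only [u, hws]; field_simp; ring
  let κ : ℕ → ℝ := fun k => Real.sqrt (1 / w k) ^ d
  have hκp : ∀ k, 0 < κ k := fun k => by have := hwp k; positivity
  let G := uldG H γ η σ ξ
  let S : ℕ → Ω → ℝ≥0∞ := fun k ω =>
    ENNReal.ofReal (κ k * Real.exp (uldQ H γ (G k ω).1 (G k ω).2 / u k))
  have hSm : ∀ k, Measurable[uldFil ξ k] (S k) := by
    intro k
    have h := uldG_meas H γ η σ ξ k
    have hQ : Measurable[uldFil ξ k] (fun ω => uldQ H γ (G k ω).1 (G k ω).2) :=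
      (uldQ_cont H γ).measurable.comp (h.1.prodMk h.2)
    exact ENNReal.measurable_ofReal.comp
      ((Real.measurable_exp.comp (hQ.div_const (u k))).const_mul (κ k))
  have hFle : ∀ k, uldFil ξ k ≤ mΩ := fun k => iSup₂_le fun i _ => (hξmeas i).comap_le
  have hind : ∀ k, Indep (uldFil ξ k) (MeasurableSpace.comap (ξ k) inferInstance) P := by
    intro k
    have h := indep_iSup_of_disjoint (fun i => (hξmeas i).comap_le) hξindep
      (S := Set.Iio k) (T := {k}) (by simp)
    simpa [uldFil] using h
  have hsup : ∀ k (φ : Ω → ℝ≥0∞), Measurable[uldFil ξ k] φ →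
      ∫⁻ ω, φ ω * S (k + 1) ω ∂P ≤ ∫⁻ ω, φ ω * S k ω ∂P := by
    intro k φ hφ
    have hm := uldG_meas H γ η σ ξ k
    let v' : Ω → EuclideanSpace ℝ (Fin d) := fun ω =>
      (G k ω).1 - η • (γ • (G k ω).1 + H (G k ω).2)
    let y' : Ω → EuclideanSpace ℝ (Fin d) := fun ω => (G k ω).2 + η • (G k ω).1
    have hv' : Measurable[uldFil ξ k] v' :=
      hm.1.sub (((hm.1.const_smul γ).add (H.continuous.measurable.comp hm.2)).const_smul η)
    have hy' : Measurable[uldFil ξ k] y' := hm.2.add (hm.1.const_smul η)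
    let g : EuclideanSpace ℝ (Fin d) × EuclideanSpace ℝ (Fin d) → EuclideanSpace ℝ (Fin d) → ℝ≥0∞ :=
      fun z x => ENNReal.ofReal (κ (k + 1) * Real.exp (uldQ H γ (z.1 + σ • x) z.2 / u (k + 1)))
    have hgc : Measurable (Function.uncurry g) := by
      have hc : Continuous (fun a : (EuclideanSpace ℝ (Fin d) × EuclideanSpace ℝ (Fin d)) ×
          EuclideanSpace ℝ (Fin d) => uldQ H γ (a.1.1 + σ • a.2) a.1.2) :=
        (uldQ_cont H γ).comp (f := fun a : (EuclideanSpace ℝ (Fin d) × EuclideanSpace ℝ (Fin d)) ×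
          EuclideanSpace ℝ (Fin d) => (a.1.1 + σ • a.2, a.1.2)) (by fun_prop)
      exact ENNReal.measurable_ofReal.comp
        ((Real.measurable_exp.comp (hc.measurable.div_const (u (k + 1)))).const_mul (κ (k + 1)))
    have e1 : ∀ ω, S (k + 1) ω = g (v' ω, y' ω) (ξ k ω) := fun ω => rfl
    simp_rw [e1]
    rw [uld_indep_lintegral (uldFil ξ k) P (hFle k) (ξ k) (hξmeas k) (hind k) φ hφ
      (fun ω => (v' ω, y' ω)) (hv'.prodMk hy') g hgc, hξ k]
    refine lintegral_mono fun ω => ?_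
    refine mul_le_mul_right ?_ _
    let s := ⟪y' ω, H (y' ω)⟫ - γ ^ 2 / 4 * ‖y' ω‖ ^ 2
    have hs : 0 ≤ s := by
      have := hlow (y' ω)
      simp only [s]; nlinarith [sq_nonneg ‖y' ω‖]
    have hlt : 2 * σ ^ 2 < u (k + 1) := by
      rw [hus]; have := mul_pos hΘ (hup k); linarith
    have e2 : ∀ x, g (v' ω, y' ω) x = ENNReal.ofReal (κ (k + 1) * Real.exp (s / u (k + 1))) *
        ENNReal.ofReal (Real.exp (‖(v' ω + (γ / 2) • y' ω) + σ • x‖ ^ 2 / u (k + 1))) := by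
      intro x
      rw [← ENNReal.ofReal_mul (by have := hκp (k + 1); positivity), mul_assoc, ← Real.exp_add]
      simp only [g, uldQ]
      congr 3
      have : v' ω + σ • x + (γ / 2) • y' ω = (v' ω + (γ / 2) • y' ω) + σ • x := by abel
      rw [this]
      simp only [s]; ring
    simp_rw [e2]
    rw [lintegral_const_mul _ (by fun_prop), uld_gauss_vec _ _ _ hlt,
      ← ENNReal.ofReal_mul (by have := hκp (k + 1); positivity)]
    apply ENNReal.ofReal_le_ofReal
    have e3 : u (k + 1) - 2 * σ ^ 2 = Θ * u k := by rw [hus]; ring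
    rw [e3]
    have hΘu : 0 < Θ * u k := mul_pos hΘ (hup k)
    have hk : κ (k + 1) * Real.sqrt (u (k + 1) / (Θ * u k)) ^ d = κ k := by
      simp only [κ]
      rw [← mul_pow, ← Real.sqrt_mul (by have := hwp (k + 1); positivity)]
      congr 2
      simp only [u]
      have h1 := (hwp k).ne'
      have h2 := (hwp (k + 1)).ne'
      field_simp
      ring
    have hst : s / u (k + 1) ≤ s / (Θ * u k) := by
      have : Θ * u k ≤ u (k + 1) := by rw [hus]; nlinarith [sq_nonneg σ]
      gcongr
    have hq : (s + ‖v' ω + (γ / 2) • y' ω‖ ^ 2) / (Θ * u k) ≤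
        uldQ H γ (G k ω).1 (G k ω).2 / u k := by
      have h1 := hstep (G k ω).1 (G k ω).2
      have h2 : s + ‖v' ω + (γ / 2) • y' ω‖ ^ 2 ≤ Θ * uldQ H γ (G k ω).1 (G k ω).2 := by
        refine le_trans (le_of_eq ?_) h1
        simp only [s, v', y', uldQ]; ring
      rw [div_le_div_iff₀ hΘu (hup k)]
      have := mul_le_mul_of_nonneg_right h2 (hup k).le
      nlinarith
    calc κ (k + 1) * Real.exp (s / u (k + 1)) * (Real.sqrt (u (k + 1) / (Θ * u k)) ^ d *
          Real.exp (‖v' ω + (γ / 2) • y' ω‖ ^ 2 / (Θ * u k)))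
        = κ k * Real.exp (s / u (k + 1) + ‖v' ω + (γ / 2) • y' ω‖ ^ 2 / (Θ * u k)) := by
          rw [Real.exp_add, ← hk]; ring
      _ ≤ κ k * Real.exp (uldQ H γ (G k ω).1 (G k ω).2 / u k) := by
          refine mul_le_mul_of_nonneg_left (Real.exp_le_exp.2 ?_) (hκp k).le
          rw [add_div] at hq; linarith
  have hmax := uld_maximal P (uldFil ξ) hFle (uldFil_mono ξ) S hSm hsup
  let U := 4 * σ ^ 2 * D * Ex
  have hU : 0 < U := by simp only [U]; positivity
  have hlam := hmax (ENNReal.ofReal (κ 0 * (1 / 2) ^ d * Real.exp (τ / U))) n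
  have hS0 : ∫⁻ ω, S 0 ω ∂P = ENNReal.ofReal (κ 0) := by
    have : ∀ ω, S 0 ω = ENNReal.ofReal (κ 0) := fun ω => by
      simp [S, G, uldG, uldQ]
    simp_rw [this]; simp
  rw [hS0] at hlam
  have hsub : {ω | ∃ k, k0 ≤ k ∧ k ≤ n ∧
        τ ≤ uldQ H γ (uldG H γ η σ ξ k ω).1 (uldG H γ η σ ξ k ω).2} ⊆
      {ω | ∃ k ≤ n, ENNReal.ofReal (κ 0 * (1 / 2) ^ d * Real.exp (τ / U)) ≤ S k ω} := by
    rintro ω ⟨k, hk0, hkn, hk⟩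
    refine ⟨k, hkn, ENNReal.ofReal_le_ofReal ?_⟩
    have h1 : κ 0 * (1 / 2) ^ d ≤ κ k := by
      simp only [κ]
      rw [← mul_pow]
      have ha := hwp k
      have hb := hw2 k hkn
      gcongr
      rw [hw0]
      apply Real.le_sqrt_of_sq_le
      rw [mul_pow, Real.sq_sqrt (by positivity)]
      rw [div_mul_eq_mul_div, div_le_div_iff₀ hw0p ha]
      nlinarith
    have h2 : u k ≤ U := by
      have ha := hw2 k hkn
      have hb := hEx k hk0 hkn
      calc u k = Θ ^ k * w k := rfl
        _ ≤ (Ex * Θ ^ n) * (2 * (2 * σ ^ 2 * D / Θ ^ n)) := by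
            have := (hwp k).le
            gcongr
        _ = U := by simp only [U]; field_simp; ring
    have h3 : τ / U ≤ uldQ H γ (G k ω).1 (G k ω).2 / u k := by
      have := hup k
      have h0 := uldQ_nonneg H γ m hlow hγ (G k ω).1 (G k ω).2
      gcongr
    calc κ 0 * (1 / 2) ^ d * Real.exp (τ / U)
        ≤ κ k * Real.exp (uldQ H γ (G k ω).1 (G k ω).2 / u k) := by
          have := (hκp k).le
          gcongr
      _ = _ := rfl
  refine le_trans (measure_mono hsub) ?_
  have hlp : 0 < κ 0 * (1 / 2) ^ d * Real.exp (τ / U) := by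
    have := hκp 0; positivity
  rw [mul_comm, ← ENNReal.le_div_iff_mul_le (Or.inl (by simpa using hlp)) (Or.inl (by simp))] at hlam
  refine le_trans hlam ?_
  rw [← ENNReal.ofReal_div_of_pos hlp]
  apply ENNReal.ofReal_le_ofReal
  rw [Real.exp_neg]
  have := (hκp 0).ne'
  apply le_of_eq
  rw [one_div, inv_pow]
  field_simp
  rfl

end Noise

/-- Linear recursion with a constant and a geometric source term. -/
lemma uld_rec (x : ℕ → ℝ) (h b α β : ℝ) (hh : 0 ≤ h) (hh1 : h < 1) (hbh : b < h) (hb : 0 ≤ b)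
    (hα : 0 ≤ α) (hβ : 0 ≤ β) (n : ℕ)
    (hx : ∀ k, k < n → x (k + 1) ≤ h * x k + α + β * b ^ k) :
    x n ≤ h ^ n * x 0 + α / (1 - h) + β * h ^ n / (h - b) := by
  have h1 : 0 < 1 - h := by linarith
  have h2 : 0 < h - b := by linarith
  have key : ∀ k, k ≤ n → x k ≤ h ^ k * x 0 + α / (1 - h) * (1 - h ^ k) + β * (h ^ k - b ^ k) / (h - b) := by
    intro k
    induction k with
    | zero => intro _; simp
    | succ k ih =>
      intro hk
      have h3 := hx k (by omega)
      have h4 := mul_le_mul_of_nonneg_left (ih (by omega)) hh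
      have e1 : h * (h ^ k * x 0 + α / (1 - h) * (1 - h ^ k) + β * (h ^ k - b ^ k) / (h - b)) + α + β * b ^ k
          = h ^ (k + 1) * x 0 + α / (1 - h) * (1 - h ^ (k + 1)) + β * (h ^ (k + 1) - b ^ (k + 1)) / (h - b) := by
        field_simp
        ring
      linarith
  refine le_trans (key n le_rfl) ?_
  have h5 : α / (1 - h) * (1 - h ^ n) ≤ α / (1 - h) := by
    have : 0 ≤ α / (1 - h) := by positivity
    have : 0 ≤ h ^ n := by positivity
    nlinarith
  have h6 : β * (h ^ n - b ^ n) / (h - b) ≤ β * h ^ n / (h - b) := by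
    have : 0 ≤ b ^ n := by positivity
    gcongr
    linarith
  linarith

/-- Second-order Taylor bound for a map with Lipschitz derivative. -/
lemma uld_taylor {E : Type*} [NormedAddCommGroup E] [NormedSpace ℝ E]
    (f : E → E) (hf : Differentiable ℝ f) (L : ℝ)
    (hL : ∀ x y, ‖fderiv ℝ f x - fderiv ℝ f y‖ ≤ L * ‖x - y‖) (z x : E) (hz : f z = 0) :
    ‖f x - fderiv ℝ f z (x - z)‖ ≤ L / 2 * ‖x - z‖ ^ 2 := by
  set y := x - z with hy
  have hd : ∀ t : ℝ, HasDerivAt (fun t : ℝ => f (z + t • y) - t • fderiv ℝ f z y)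
      (fderiv ℝ f (z + t • y) y - fderiv ℝ f z y) t := by
    intro t
    have h1 : HasDerivAt (fun t : ℝ => z + t • y) y t := by
      simpa using ((hasDerivAt_id t).smul_const y).const_add z
    have h2 := (hf (z + t • y)).hasFDerivAt.comp_hasDerivAt t h1
    have h3 : HasDerivAt (fun t : ℝ => t • fderiv ℝ f z y) (fderiv ℝ f z y) t := by
      simpa using (hasDerivAt_id t).smul_const (fderiv ℝ f z y)
    exact h2.sub h3
  have hB : ∀ t : ℝ, HasDerivAt (fun t : ℝ => L / 2 * ‖y‖ ^ 2 * t ^ 2) (L * ‖y‖ ^ 2 * t) t := by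
    intro t
    have := (hasDerivAt_pow 2 t).const_mul (L / 2 * ‖y‖ ^ 2)
    have e1 : L * ‖y‖ ^ 2 * t = L / 2 * ‖y‖ ^ 2 * (((2 : ℕ) : ℝ) * t ^ (2 - 1)) := by
      norm_num; ring
    rw [e1]
    exact this
  have := image_norm_le_of_norm_deriv_right_le_deriv_boundary'
    (f := fun t : ℝ => f (z + t • y) - t • fderiv ℝ f z y) (a := 0) (b := 1)
    (f' := fun t => fderiv ℝ f (z + t • y) y - fderiv ℝ f z y)
    (fun t _ => (hd t).continuousAt.continuousWithinAt)
    (fun t _ => (hd t).hasDerivWithinAt)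
    (B := fun t => L / 2 * ‖y‖ ^ 2 * t ^ 2) (B' := fun t => L * ‖y‖ ^ 2 * t)
    (by simp [hz]) (fun t _ => (hB t).continuousAt.continuousWithinAt)
    (fun t _ => (hB t).hasDerivWithinAt)
    (fun t ht => by
      have h1 := hL (z + t • y) z
      rw [add_sub_cancel_left, norm_smul, Real.norm_eq_abs, abs_of_nonneg ht.1] at h1
      have h2 := (fderiv ℝ f (z + t • y) - fderiv ℝ f z).le_opNorm y
      have h3 := mul_le_mul_of_nonneg_right h1 (norm_nonneg y)
      calc _ ≤ _ := h2
        _ ≤ _ := h3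
        _ = _ := by ring)
    (x := 1) (by simp)
  simpa [hy] using this

lemma uld_grad_diff {E : Type*} [NormedAddCommGroup E] [InnerProductSpace ℝ E] [CompleteSpace E]
    (F : E → ℝ) (hF : ContDiff ℝ 2 F) : Differentiable ℝ (∇ F) := by
  have h1 : ContDiff ℝ 1 (fderiv ℝ F) := hF.fderiv_right (by norm_num)
  have h2 : ∇ F = fun x => (InnerProductSpace.toDual ℝ E).symm (fderiv ℝ F x) := rfl
  rw [h2]
  exact ((InnerProductSpace.toDual ℝ E).symm.toContinuousLinearEquiv.toContinuousLinearMap.contDiff.comp h1).differentiable (by norm_num)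

lemma uld_grad_zero {E : Type*} [NormedAddCommGroup E] [InnerProductSpace ℝ E] [CompleteSpace E]
    (F : E → ℝ) (z : E) (hz : IsLocalMin F z) : ∇ F z = 0 := by
  have h2 : ∇ F z = (InnerProductSpace.toDual ℝ E).symm (fderiv ℝ F z) := rfl
  rw [h2, hz.fderiv_eq_zero]; simp

/-- Quadratic form lower bound from the eigenvalues. -/
lemma uld_quad_lower {d : ℕ} (H : Matrix (Fin d) (Fin d) ℝ) (hH : H.IsHermitian) (m : ℝ)
    (hm : ∀ i, m ≤ hH.eigenvalues i) (y : EuclideanSpace ℝ (Fin d)) :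
    m * ‖y‖ ^ 2 ≤ ⟪y, Matrix.toEuclideanCLM (𝕜 := ℝ) H y⟫ := by
  let b := hH.eigenvectorBasis
  have hev : ∀ i, Matrix.toEuclideanCLM (𝕜 := ℝ) H (b i) = hH.eigenvalues i • b i := by
    intro i
    have h := hH.mulVec_eigenvectorBasis i
    ext j
    have := congrFun h j
    simpa using this
  have hy : y = ∑ i, ⟪b i, y⟫ • b i := (b.sum_repr' y).symm
  have e1 : Matrix.toEuclideanCLM (𝕜 := ℝ) H y = ∑ i, (⟪b i, y⟫ * hH.eigenvalues i) • b i := by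
    conv_lhs => rw [hy]
    rw [map_sum]
    refine Finset.sum_congr rfl fun i _ => ?_
    rw [map_smul, hev, smul_smul]
  rw [e1, inner_sum, ← b.sum_sq_norm_inner_right y, Finset.mul_sum]
  refine Finset.sum_le_sum fun i _ => ?_
  rw [real_inner_smul_right, real_inner_comm (b i) y, Real.norm_eq_abs, sq_abs]
  nlinarith [hm i, sq_nonneg ⟪b i, y⟫]

lemma uld_sym {d : ℕ} (H : Matrix (Fin d) (Fin d) ℝ) (hH : H.IsHermitian)
    (x y : EuclideanSpace ℝ (Fin d)) :
    ⟪Matrix.toEuclideanCLM (𝕜 := ℝ) H x, y⟫ = ⟪x, Matrix.toEuclideanCLM (𝕜 := ℝ) H y⟫ := by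
  have := Matrix.isSymmetric_toEuclideanLin_iff.2 hH
  exact this x y

lemma uld_exp_gap (x : ℝ) (hx : 0 < x) : x / (1 + x) ≤ 1 - Real.exp (-x) := by
  have h1 := Real.add_one_le_exp x
  have h2 : Real.exp (-x) ≤ 1 / (1 + x) := by
    rw [Real.exp_neg, ← one_div]
    exact one_div_le_one_div_of_le (by linarith) (by linarith)
  have h3 : x / (1 + x) = 1 - 1 / (1 + x) := by field_simp; ring
  linarith

/-- For `x = η κ` one has `η / (1 - exp (-x)) ≤ (1 + x) / κ`. -/
lemma uld_gap_div (η κ t : ℝ) (hη : 0 < η) (hκ : 0 < κ) (ht : η * κ ≤ t) :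
    η / (1 - Real.exp (-(η * κ))) ≤ (1 + t) / κ := by
  have hx : 0 < η * κ := by positivity
  have h1 := uld_exp_gap (η * κ) hx
  have h0 : 0 < η * κ / (1 + η * κ) := by positivity
  calc η / (1 - Real.exp (-(η * κ))) ≤ η / (η * κ / (1 + η * κ)) := by gcongr
    _ = (1 + η * κ) / κ := by field_simp
    _ ≤ _ := by gcongr

lemma uld_sqrt_half (M : ℝ) (hM : 0 < M) : √M ≤ (1 + M) / 2 := by
  have := Real.sq_sqrt hM.le
  nlinarith [sq_nonneg (√M - 1)]

/-- Deterministic estimate, moderate friction case. -/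
lemma uld_case1 (e ρ : ℕ → ℝ) (γ η M L c C ε r : ℝ) (n : ℕ) (hγ : 0 < γ) (hη : 0 < η)
    (hM : 0 < M) (hL : 0 < L) (hc : 0 < c) (hC : 0 < C) (hε : 0 < ε) (hr : 0 < r)
    (hηγ : η * γ ≤ 2 / 5) (hnM : η * M * (n * η) ≤ 5 / 24)
    (hεL : C * L * ε * (1 + 1 / (64 * C ^ 2)) ≤ γ / 8) (hCc : C * c = 1 + M)
    (hn : Real.exp (-(γ / 2) * (n * η)) ≤ (ε / (8 * r * C)) ^ 2)
    (hE : ε / (8 * r * C) ≤ 1)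
    (he0 : e 0 ≤ √M * r)
    (he : ∀ k, k < n → e (k + 1) ≤ Real.exp ((-(η * γ) + η ^ 2 * M) / 2) * e k + η * ρ k)
    (hρ : ∀ k, k < n → ρ k ≤ L * (ε ^ 2 + r ^ 2 * Real.exp (-(η * γ)) ^ k)) :
    e n ≤ 2 / 3 * ε * c := by
  set g := Real.exp (η ^ 2 * M / 2) with hg
  set h := Real.exp (-(η * (γ / 2))) with hh
  set b := Real.exp (-(η * γ)) with hb
  have hx : 0 < η * (γ / 2) := by positivity
  have hg1 : 1 ≤ g := Real.one_le_exp (by positivity)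
  have hg0 : 0 < g := by linarith
  have hh0 : 0 < h := Real.exp_pos _
  have hb0 : 0 < b := Real.exp_pos _
  have hh1 : h < 1 := by rw [hh, Real.exp_lt_one_iff]; linarith
  have hbh2 : b = h * h := by rw [hb, hh, ← Real.exp_add]; congr 1; ring
  have hbh : b < h := by rw [hbh2]; nlinarith
  have hq : Real.exp ((-(η * γ) + η ^ 2 * M) / 2) = g * h := by
    rw [hg, hh, ← Real.exp_add]; congr 1; ring
  have hrec := uld_rec (fun k => e k / g ^ k) h b (η * L * ε ^ 2) (η * L * r ^ 2) hh0.le hh1 hbh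
    hb0.le (by positivity) (by positivity) n (by
      intro k hk
      have h1 := he k hk
      rw [hq] at h1
      have h2 := hρ k hk
      have hgk : 1 ≤ g ^ (k + 1) := one_le_pow₀ hg1
      have hbk : 0 < b ^ k := by positivity
      have h3 : e (k + 1) / g ^ (k + 1) ≤ (g * h * e k + η * (L * (ε ^ 2 + r ^ 2 * b ^ k))) / g ^ (k + 1) := by
        gcongr
        linarith [mul_le_mul_of_nonneg_left h2 hη.le]
      have h4 : η * (L * (ε ^ 2 + r ^ 2 * b ^ k)) / g ^ (k + 1) ≤ η * (L * (ε ^ 2 + r ^ 2 * b ^ k)) :=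
        div_le_self (by positivity) hgk
      have h5 : g * h * e k / g ^ (k + 1) = h * (e k / g ^ k) := by
        rw [pow_succ]; field_simp
      rw [add_div, h5] at h3
      show e (k + 1) / g ^ (k + 1) ≤ h * (e k / g ^ k) + η * L * ε ^ 2 + η * L * r ^ 2 * b ^ k
      linarith)
  have hhn : h ^ n ≤ (ε / (8 * r * C)) ^ 2 := by
    refine le_trans (le_of_eq ?_) hn
    rw [hh, ← Real.exp_nat_mul]; congr 1; ring
  have hE0 : 0 < ε / (8 * r * C) := by positivity
  have hgn : g ^ n ≤ 3 / 2 := by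
    rw [hg, ← Real.exp_nat_mul]
    have h1 : (n : ℝ) * (η ^ 2 * M / 2) ≤ 1 / 4 := by nlinarith
    have h2 := Real.exp_bound_div_one_sub_of_interval (x := 1 / 4) (by norm_num) (by norm_num)
    calc _ ≤ Real.exp (1 / 4) := Real.exp_le_exp.2 h1
      _ ≤ _ := h2
      _ ≤ _ := by norm_num
  have hgap := uld_gap_div η (γ / 2) (1 / 5) hη (by positivity) (by linarith)
  rw [← hh] at hgap
  have hgap' : η / (1 - h) ≤ (12 / 5) / γ := by
    refine le_trans hgap (le_of_eq ?_); field_simp; norm_num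
  have h45 : 4 / 5 ≤ h := by
    have := Real.add_one_le_exp (-(η * (γ / 2)))
    linarith
  have hCinv : 1 ≤ C * c := by linarith
  have t1 : h ^ n * (e 0 / g ^ 0) ≤ ε * c / 16 := by
    have hs := uld_sqrt_half M hM
    have h1 : h ^ n ≤ ε / (8 * r * C) := by nlinarith
    calc h ^ n * (e 0 / g ^ 0) = h ^ n * e 0 := by simp
      _ ≤ h ^ n * ((1 + M) / 2 * r) := by
          gcongr
          exact he0.trans (by gcongr)
      _ ≤ ε / (8 * r * C) * ((1 + M) / 2 * r) := by gcongr
      _ = ε * c / 16 := by rw [← hCc]; field_simp; norm_num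
  have t2 : η * L * ε ^ 2 / (1 - h) ≤ 3 / γ * (L * ε ^ 2) := by
    calc η * L * ε ^ 2 / (1 - h) = η / (1 - h) * (L * ε ^ 2) := by ring
      _ ≤ (12 / 5) / γ * (L * ε ^ 2) := by gcongr
      _ ≤ _ := by gcongr; norm_num
  have h1h : 0 < 1 - h := by linarith
  have t3 : η * L * r ^ 2 * h ^ n / (h - b) ≤ 3 / γ * (L * ε ^ 2) * (1 / (64 * C ^ 2)) := by
    have e1 : h - b = h * (1 - h) := by rw [hbh2]; ring
    calc η * L * r ^ 2 * h ^ n / (h - b) = η / (1 - h) * (1 / h) * (L * r ^ 2) * h ^ n := by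
          rw [e1]; field_simp
      _ ≤ (12 / 5) / γ * (1 / (4 / 5)) * (L * r ^ 2) * (ε / (8 * r * C)) ^ 2 := by gcongr
      _ = _ := by field_simp; norm_num
  have t4 : 3 / γ * (L * ε ^ 2) + 3 / γ * (L * ε ^ 2) * (1 / (64 * C ^ 2)) ≤ 3 / 8 * ε * c := by
    have : 3 / γ * (L * ε ^ 2) + 3 / γ * (L * ε ^ 2) * (1 / (64 * C ^ 2))
        = 3 / γ * (ε / C) * (C * L * ε * (1 + 1 / (64 * C ^ 2))) := by field_simp
    rw [this]
    calc _ ≤ 3 / γ * (ε / C) * (γ / 8) := by gcongr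
      _ = 3 / 8 * ε * (1 / C) := by field_simp
      _ ≤ 3 / 8 * ε * c := by
        gcongr; rw [div_le_iff₀ hC]; linarith
  have hxn : e n / g ^ n ≤ 7 / 16 * (ε * c) := by
    have h9 : e n / g ^ n ≤ h ^ n * (e 0 / g ^ 0) + η * L * ε ^ 2 / (1 - h)
      + η * L * r ^ 2 * h ^ n / (h - b) := hrec
    linarith
  rw [div_le_iff₀ (by positivity)] at hxn
  have hεc : 0 < ε * c := by positivity
  have h10 : 7 / 16 * (ε * c) * g ^ n ≤ 7 / 16 * (ε * c) * (3 / 2) := by gcongr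
  linarith

/-- Deterministic estimate, case `γ > 60 M`. -/
lemma uld_case2 (e ρ : ℕ → ℝ) (γ η M L c C ε r : ℝ) (n : ℕ) (hγ : 0 < γ) (hη : 0 < η)
    (hη1 : η ≤ 1)
    (hM : 0 < M) (hL : 0 < L) (hc : 0 < c) (hC : 0 < C) (hε : 0 < ε) (hr : 0 < r)
    (hηγ : η * γ ≤ 2 / 5) (hγM : 60 * M ≤ γ)
    (hεL : C * L * ε * (1 + 1 / (64 * C ^ 2)) ≤ γ / 8) (hCc : C * c = 1 + M)
    (hn : Real.exp (-(γ / 2) * (n * η)) ≤ (ε / (8 * r * C)) ^ 2)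
    (he0 : e 0 ≤ √M * r) (he0' : ∀ k, 0 ≤ e k)
    (he : ∀ k, k < n → e (k + 1) ≤ Real.exp ((-(η * γ) + η ^ 2 * M) / 2) * e k + η * ρ k)
    (hρ : ∀ k, k < n → ρ k ≤ 9 / 8 * L * ε ^ 2 + 6 * M * (r * Real.exp (-(η * (γ / 2))) ^ k)) :
    e n ≤ 2 / 3 * ε * c := by
  set h := Real.exp (-(η * (γ / 3))) with hh
  set b := Real.exp (-(η * (γ / 2))) with hb
  have hx : 0 < η * γ := by positivity
  have hh0 : 0 < h := Real.exp_pos _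
  have hb0 : 0 < b := Real.exp_pos _
  have hh1 : h < 1 := by rw [hh, Real.exp_lt_one_iff]; linarith
  have hbh2 : b = h * Real.exp (-(η * (γ / 6))) := by
    rw [hb, hh, ← Real.exp_add]; congr 1; ring
  have hbh : b < h := by rw [hb, hh, Real.exp_lt_exp]; linarith
  have hq : Real.exp ((-(η * γ) + η ^ 2 * M) / 2) ≤ h := by
    rw [hh, Real.exp_le_exp]
    have : η * (η * M) ≤ η * (γ / 60) := by
      gcongr; nlinarith
    nlinarith
  have hrec := uld_rec e h b (9 / 8 * η * L * ε ^ 2) (6 * η * M * r) hh0.le hh1 hbh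
    hb0.le (by positivity) (by positivity) n (by
      intro k hk
      have h1 := he k hk
      have h2 := mul_le_mul_of_nonneg_left (hρ k hk) hη.le
      have h3 := mul_le_mul_of_nonneg_right hq (he0' k)
      linarith)
  have hE0 : 0 < ε / (8 * r * C) := by positivity
  have hhn : h ^ n ≤ ε / (8 * r * C) := by
    have h1 : Real.exp (-(γ / 4) * (n * η)) ≤ ε / (8 * r * C) := by
      refine le_of_sq_le_sq ?_ hE0.le
      refine le_trans (le_of_eq ?_) hn
      rw [sq, ← Real.exp_add]; congr 1; ring
    refine le_trans ?_ h1
    rw [hh, ← Real.exp_nat_mul, Real.exp_le_exp]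
    have : 0 ≤ γ * (n * η) := by positivity
    linarith
  have hgap : η / (1 - h) ≤ (17 / 5) / γ := by
    refine le_trans (uld_gap_div η (γ / 3) (2 / 15) hη (by positivity) (by linarith)) (le_of_eq ?_)
    field_simp; norm_num
  have hgap2 : η / (1 - Real.exp (-(η * (γ / 6)))) ≤ (32 / 5) / γ := by
    refine le_trans (uld_gap_div η (γ / 6) (1 / 15) hη (by positivity) (by linarith)) (le_of_eq ?_)
    field_simp; norm_num
  have h45 : 13 / 15 ≤ h := by
    have := Real.add_one_le_exp (-(η * (γ / 3)))
    linarith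
  have hCinv : 1 / C ≤ c := by rw [div_le_iff₀ hC]; linarith
  have t1 : h ^ n * e 0 ≤ ε * c / 16 := by
    have hs := uld_sqrt_half M hM
    calc h ^ n * e 0 ≤ h ^ n * ((1 + M) / 2 * r) := by
          gcongr
          exact he0.trans (by gcongr)
      _ ≤ ε / (8 * r * C) * ((1 + M) / 2 * r) := by gcongr
      _ = ε * c / 16 := by rw [← hCc]; field_simp; norm_num
  have hεL' : C * L * ε ≤ γ / 8 := by
    refine le_trans ?_ hεL
    have : 0 ≤ 1 / (64 * C ^ 2) := by positivity
    have h2 : 0 ≤ C * L * ε := by positivity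
    nlinarith
  have h1h : 0 < 1 - h := by linarith
  have t2 : 9 / 8 * η * L * ε ^ 2 / (1 - h) ≤ 153 / 320 * ε * c := by
    calc 9 / 8 * η * L * ε ^ 2 / (1 - h) = η / (1 - h) * (9 / 8) * (ε / C) * (C * L * ε) := by
          field_simp
      _ ≤ (17 / 5) / γ * (9 / 8) * (ε / C) * (γ / 8) := by gcongr
      _ = 153 / 320 * ε * (1 / C) := by field_simp; norm_num
      _ ≤ _ := by gcongr
  have hb6 : 0 < 1 - Real.exp (-(η * (γ / 6))) := by
    have : Real.exp (-(η * (γ / 6))) < 1 := by rw [Real.exp_lt_one_iff]; linarith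
    linarith
  have t3 : 6 * η * M * r * h ^ n / (h - b) ≤ 1 / 10 * ε * c := by
    have e1 : h - b = h * (1 - Real.exp (-(η * (γ / 6)))) := by rw [hbh2]; ring
    calc 6 * η * M * r * h ^ n / (h - b)
        = η / (1 - Real.exp (-(η * (γ / 6)))) * (1 / h) * (6 * M * r) * h ^ n := by
          rw [e1]; field_simp
      _ ≤ (32 / 5) / γ * (1 / (13 / 15)) * (6 * (γ / 60) * r) * (ε / (8 * r * C)) := by
          gcongr; linarith
      _ = (32 / 5) * (15 / 13) * (6 / 60) / 8 * ε * (1 / C) := by field_simp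
      _ ≤ (32 / 5) * (15 / 13) * (6 / 60) / 8 * ε * c := by gcongr
      _ ≤ 1 / 10 * ε * c := by
          have h0 : 0 < ε * c := by positivity
          linarith
  have hεc : 0 < ε * c := by positivity
  linarith

/-- Bound of the geometric sum in the variance proxy. -/
lemma uld_sum (γ η M : ℝ) (n : ℕ) (hγ : 0 < γ) (hη : 0 < η) (hM : 0 < M)
    (hηγ : η * γ ≤ 2 / 5)
    (hcase : η * M * (n * η) ≤ 5 / 24 ∨ η * M ≤ γ / 60) :
    ∑ i ∈ Finset.range n, Real.exp (-(η * γ) + η ^ 2 * M) ^ i ≤ 7 / 4 / (η * γ) := by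
  have hx : 0 < η * γ := by positivity
  have geo : ∀ t : ℝ, 0 < t → ∑ i ∈ Finset.range n, Real.exp (-t) ^ i ≤ (1 + t) / t := by
    intro t ht
    have h1 : Real.exp (-t) < 1 := by rw [Real.exp_lt_one_iff]; linarith
    have h2 := uld_exp_gap t ht
    have h0 : 0 < t / (1 + t) := by positivity
    rw [geom_sum_eq h1.ne, ← neg_div_neg_eq, neg_sub, neg_sub]
    calc (1 - Real.exp (-t) ^ n) / (1 - Real.exp (-t)) ≤ 1 / (t / (1 + t)) := by
          have : 0 ≤ Real.exp (-t) ^ n := by positivity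
          gcongr; linarith
      _ = _ := by field_simp
  rcases hcase with hc | hc
  · have h1 : ∀ i ∈ Finset.range n, Real.exp (-(η * γ) + η ^ 2 * M) ^ i
        ≤ 5 / 4 * Real.exp (-(η * γ)) ^ i := by
      intro i hi
      have hin : (i : ℝ) ≤ n := by exact_mod_cast (Finset.mem_range.1 hi).le
      rw [Real.exp_add, mul_pow, mul_comm]
      gcongr
      rw [← Real.exp_nat_mul]
      have h3 : (i : ℝ) * (η ^ 2 * M) ≤ 5 / 24 := by
        calc (i : ℝ) * (η ^ 2 * M) ≤ n * (η ^ 2 * M) := by gcongr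
          _ = η * M * (n * η) := by ring
          _ ≤ _ := hc
      have h4 := Real.exp_bound' (x := 5 / 24) (by norm_num) (by norm_num) (n := 3) (by norm_num)
      calc _ ≤ Real.exp (5 / 24) := Real.exp_le_exp.2 h3
        _ ≤ _ := h4
        _ ≤ _ := by norm_num [Finset.sum_range_succ, Nat.factorial]
    calc _ ≤ ∑ i ∈ Finset.range n, 5 / 4 * Real.exp (-(η * γ)) ^ i := Finset.sum_le_sum h1
      _ = 5 / 4 * ∑ i ∈ Finset.range n, Real.exp (-(η * γ)) ^ i := by rw [Finset.mul_sum]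
      _ ≤ 5 / 4 * ((1 + η * γ) / (η * γ)) := by gcongr; exact geo _ hx
      _ ≤ 5 / 4 * ((1 + 2 / 5) / (η * γ)) := by gcongr
      _ = _ := by field_simp; norm_num
  · have h2 : η ^ 2 * M ≤ η * γ / 60 := by nlinarith
    have ht : 0 < 59 / 60 * (η * γ) := by positivity
    calc _ ≤ ∑ i ∈ Finset.range n, Real.exp (-(59 / 60 * (η * γ))) ^ i := by
          gcongr; linarith
      _ ≤ _ := geo _ ht
      _ ≤ (1 + 59 / 60 * (2 / 5)) / (59 / 60 * (η * γ)) := by gcongr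
      _ ≤ _ := by
        rw [div_le_div_iff₀ ht hx]; nlinarith

/-- The deterministic part: small noise on the window implies staying near the minimum. -/
lemma uld_path {E : Type*} [NormedAddCommGroup E] [InnerProductSpace ℝ E]
    (T : E →L[ℝ] E) (γ m M L η c C ε r Trec Tesc : ℝ)
    (hsym : ∀ x y, ⟪T x, y⟫ = ⟪x, T y⟫) (hlow : ∀ y, m * ‖y‖ ^ 2 ≤ ⟪y, T y⟫)
    (hup : ∀ y, ⟪y, T y⟫ ≤ M * ‖y‖ ^ 2) (hγm : γ ^ 2 / 4 < m) (hmM : m ≤ M)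
    (hγ : 0 < γ) (hη : 0 < η) (hη1 : η ≤ 1) (hM : 0 < M) (hL : 0 < L) (hc : 0 < c)
    (hc2 : c ^ 2 = m - γ ^ 2 / 4) (hC : 0 < C) (hε : 0 < ε) (hr : 0 < r)
    (hηγ : η * γ ≤ 2 / 5)
    (hcase : (∀ n : ℕ, n * η ≤ Tesc → η * M * (n * η) ≤ 5 / 24) ∨ 60 * M ≤ γ)
    (hεL : C * L * ε * (1 + 1 / (64 * C ^ 2)) ≤ γ / 8) (hCc : C * c = 1 + M)
    (hTr : ∀ n : ℕ, Trec ≤ n * η → Real.exp (-(γ / 2) * (n * η)) ≤ (ε / (8 * r * C)) ^ 2)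
    (hE : ε / (8 * r * C) ≤ 1)
    (f : E → E) (xs : E) (hf1 : ∀ x, ‖f x - T (x - xs)‖ ≤ L / 2 * ‖x - xs‖ ^ 2)
    (hf2 : ∀ x, ‖f x - T (x - xs)‖ ≤ 2 * M * ‖x - xs‖)
    (X V w : ℕ → E) (G : ℕ → E × E) (hG0 : G 0 = (0, 0))
    (hG : ∀ k, G (k + 1) = ((G k).1 - η • (γ • (G k).1 + T (G k).2) + w k, (G k).2 + η • (G k).1))
    (hV0 : V 0 = 0) (hX0 : ‖X 0 - xs‖ ≤ r)
    (hV : ∀ k, V (k + 1) = V k - η • (γ • V k + f (X k)) + w k)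
    (hX : ∀ k, X (k + 1) = X k + η • V k)
    (hrec : ∀ k : ℕ, k * η ≤ Trec → ‖X k - xs‖ ≤ ε + r * Real.exp (-(γ / 2) * (k * η)))
    (hGb : ∀ k : ℕ, Trec ≤ k * η → k * η ≤ Tesc → uldQ T γ (G k).1 (G k).2 ≤ (ε * c / 3) ^ 2) :
    ∀ k : ℕ, Trec ≤ k * η → k * η ≤ Tesc → ‖X k - xs‖ ≤ ε := by
  -- the remainder process
  let U1 : ℕ → E := fun k => V k - (G k).1
  let U2 : ℕ → E := fun k => X k - xs - (G k).2
  let ρ : ℕ → E := fun k => f (X k) - T (X k - xs)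
  let e : ℕ → ℝ := fun k => √(uldQ T γ (U1 k) (U2 k))
  have hU1 : ∀ k, U1 (k + 1) = (U1 k - η • (γ • U1 k + T (U2 k))) + (-(η • ρ k)) := by
    intro k
    simp only [U1, U2, ρ, hV, hG, map_sub, smul_sub, smul_add]
    abel
  have hU2 : ∀ k, U2 (k + 1) = U2 k + η • U1 k := by
    intro k
    simp only [U1, U2, hX, hG, smul_sub]
    abel
  have he : ∀ k, e (k + 1) ≤ Real.exp ((-(η * γ) + η ^ 2 * M) / 2) * e k + η * ‖ρ k‖ := by
    intro k
    have h1 := uldQ_add T γ m hlow hγm (U1 k - η • (γ • U1 k + T (U2 k))) (U2 k + η • U1 k)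
      (-(η • ρ k))
    rw [← hU1, ← hU2, norm_neg, norm_smul, Real.norm_eq_abs, abs_of_pos hη] at h1
    refine h1.trans ?_
    gcongr
    have h2 := uldQ_step T γ m M η hsym hlow hup hγm hmM (U1 k) (U2 k)
    rw [← hU2] at h2
    have h3 := uldQ_nonneg T γ m hlow hγm (U1 k) (U2 k)
    have h4 : 1 - η * γ + η ^ 2 * M ≤ Real.exp (-(η * γ) + η ^ 2 * M) := by
      have := Real.add_one_le_exp (-(η * γ) + η ^ 2 * M)
      linarith
    calc _ ≤ √(Real.exp (-(η * γ) + η ^ 2 * M) * uldQ T γ (U1 k) (U2 k)) :=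
          Real.sqrt_le_sqrt (h2.trans (mul_le_mul_of_nonneg_right h4 h3))
      _ = _ := by
        rw [Real.sqrt_mul (Real.exp_pos _).le, Real.exp_half]
  have hpos : ∀ v y, c * ‖y‖ ≤ √(uldQ T γ v y) := by
    intro v y
    refine Real.le_sqrt_of_sq_le ?_
    rw [mul_pow, hc2]
    exact uldQ_lower T γ m hlow v y
  have he0 : e 0 ≤ √M * r := by
    have h1 : uldQ T γ (U1 0) (U2 0) ≤ M * r ^ 2 := by
      have a1 : U1 0 = 0 := by simp [U1, hV0, hG0]
      have a2 : U2 0 = X 0 - xs := by simp [U2, hG0]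
      rw [a1, a2]
      have h2 := hup (X 0 - xs)
      have h3 : ‖X 0 - xs‖ ^ 2 ≤ r ^ 2 := by gcongr
      simp only [uldQ, zero_add, norm_smul, Real.norm_eq_abs]
      rw [mul_pow, sq_abs]
      nlinarith
    calc e 0 ≤ √(M * r ^ 2) := Real.sqrt_le_sqrt h1
      _ = √M * r := by rw [Real.sqrt_mul hM.le, Real.sqrt_sq hr.le]
  intro k
  induction k using Nat.strong_induction_on with
  | _ k ih =>
    intro hk1 hk2
    have hY : ∀ j, j < k → ‖X j - xs‖ ≤ ε + r * Real.exp (-(γ / 2) * (j * η)) := by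
      intro j hj
      by_cases hjT : (j : ℝ) * η ≤ Trec
      · exact hrec j hjT
      · have hjk : (j : ℝ) * η ≤ k * η := by
          have : (j : ℝ) ≤ k := by exact_mod_cast hj.le
          gcongr
        have h1 := ih j hj (not_le.1 hjT).le (hjk.trans hk2)
        have : 0 ≤ r * Real.exp (-(γ / 2) * (j * η)) := by positivity
        linarith
    have hek : e k ≤ 2 / 3 * ε * c := by
      rcases hcase with hcs | hcs
      · refine uld_case1 e (fun j => ‖ρ j‖) γ η M L c C ε r k hγ hη hM hL hc hC hε hr hηγ
          (hcs k hk2) hεL hCc (hTr k hk1) hE he0 (fun j _ => he j) ?_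
        intro j hj
        have h1 := hf1 (X j)
        have h2 : ‖X j - xs‖ ^ 2 ≤ (ε + r * Real.exp (-(γ / 2) * (j * η))) ^ 2 := by
          gcongr; exact hY j hj
        have h3 : Real.exp (-(η * γ)) ^ j = Real.exp (-(γ / 2) * (j * η)) ^ 2 := by
          rw [← Real.exp_nat_mul, ← Real.exp_nat_mul]; congr 1; push_cast; ring
        rw [h3]
        set a := Real.exp (-(γ / 2) * (j * η))
        have h4 : (ε + r * a) ^ 2 ≤ 2 * (ε ^ 2 + r ^ 2 * a ^ 2) := by
          nlinarith [sq_nonneg (ε - r * a)]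
        have h5 : L / 2 * ‖X j - xs‖ ^ 2 ≤ L / 2 * (2 * (ε ^ 2 + r ^ 2 * a ^ 2)) := by
          gcongr; exact h2.trans h4
        show ‖ρ j‖ ≤ _
        calc ‖ρ j‖ ≤ _ := h1
          _ ≤ _ := h5
          _ = _ := by ring
      · refine uld_case2 e (fun j => ‖ρ j‖) γ η M L c C ε r k hγ hη hη1 hM hL hc hC hε hr hηγ
          hcs hεL hCc (hTr k hk1) he0 (fun j => Real.sqrt_nonneg _) (fun j _ => he j) ?_
        intro j hj
        have h1 := hf1 (X j)
        have h1' := hf2 (X j)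
        have h2 := hY j hj
        have h3 : Real.exp (-(η * (γ / 2))) ^ j = Real.exp (-(γ / 2) * (j * η)) := by
          rw [← Real.exp_nat_mul]; congr 1; ring
        rw [h3]
        set a := r * Real.exp (-(γ / 2) * (j * η))
        have ha : 0 < a := by positivity
        show ‖ρ j‖ ≤ _
        by_cases hae : a ≤ ε / 2
        · have h4 : ‖X j - xs‖ ^ 2 ≤ (3 / 2 * ε) ^ 2 := by
            gcongr; linarith
          have h5 : L / 2 * ‖X j - xs‖ ^ 2 ≤ L / 2 * (3 / 2 * ε) ^ 2 := by gcongr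
          have h6 : 0 < M * a := by positivity
          have h7 : ‖ρ j‖ ≤ L / 2 * (3 / 2 * ε) ^ 2 := h1.trans h5
          nlinarith
        · have h4 : 2 * M * ‖X j - xs‖ ≤ 2 * M * (3 * a) := by
            gcongr; linarith
          have h6 : 0 < L * ε ^ 2 := by positivity
          have h7 : ‖ρ j‖ ≤ 2 * M * (3 * a) := h1'.trans h4
          linarith
    have hU := hpos (U1 k) (U2 k)
    have hGk := hpos (G k).1 (G k).2
    have hGk2 : √(uldQ T γ (G k).1 (G k).2) ≤ ε * c / 3 :=
      Real.sqrt_le_iff.2 ⟨by positivity, hGb k hk1 hk2⟩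
    have hsum : ‖X k - xs‖ ≤ ‖U2 k‖ + ‖(G k).2‖ := by
      have : X k - xs = U2 k + (G k).2 := by simp [U2]
      rw [this]; exact norm_add_le _ _
    have hU' : c * ‖U2 k‖ ≤ 2 / 3 * ε * c := hU.trans hek
    have : c * ‖X k - xs‖ ≤ c * ε := by
      have := mul_le_mul_of_nonneg_left hsum hc.le
      linarith
    exact le_of_mul_le_mul_left this hc

lemma uld_exp_half_le : Real.exp (1 / 2) ≤ 33 / 20 := by
  refine le_of_sq_le_sq ?_ (by norm_num)
  have h1 := Real.exp_one_lt_d9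
  have h2 : Real.exp (1 / 2) ^ 2 = Real.exp 1 := by
    rw [sq, ← Real.exp_add]; norm_num
  rw [h2]
  norm_num
  linarith

set_option maxHeartbeats 2000000 in
/-- Union bound over blocks: the linear noise stays small on the whole window. -/
lemma uld_noise_union {Ω : Type*} {d : ℕ} [MeasurableSpace Ω] (P : Measure Ω)
    [IsProbabilityMeasure P]
    (T : EuclideanSpace ℝ (Fin d) →L[ℝ] EuclideanSpace ℝ (Fin d))
    (γ m M η β c C ε δ 𝒯 Trec Tesc : ℝ)
    (hsym : ∀ x y, ⟪T x, y⟫ = ⟪x, T y⟫) (hlow : ∀ y, m * ‖y‖ ^ 2 ≤ ⟪y, T y⟫)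
    (hup : ∀ y, ⟪y, T y⟫ ≤ M * ‖y‖ ^ 2) (hγm : γ ^ 2 / 4 < m) (hmM : m ≤ M)
    (hγ : 0 < γ) (hη : 0 < η) (hβ0 : 0 < β) (hM : 0 < M) (hc : 0 < c)
    (hC : 0 < C) (hε : 0 < ε) (hδ0 : 0 < δ) (hδ1 : δ < 1) (h𝒯 : 0 < 𝒯) (hTesc0 : 0 < Tesc)
    (hTesc : Tesc = Trec + 𝒯)
    (hηγ : η * γ ≤ 2 / 5)
    (hcase : (∀ n : ℕ, n * η ≤ Tesc → η * M * (n * η) ≤ 5 / 24) ∨ η * M ≤ γ / 60)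
    (hCc : 1 ≤ C * c)
    (hβ : 256 * C ^ 2 / ε ^ 2 * (d * Real.log 2 +
      Real.log ((6 * √(γ ^ 2 + M ^ 2 + 1) * 𝒯 + 3) / δ)) ≤ β)
    (ξ : ℕ → Ω → EuclideanSpace ℝ (Fin d)) (hξmeas : ∀ k, Measurable (ξ k))
    (hξindep : iIndepFun ξ P) (hξ : ∀ k, Measure.map (ξ k) P = stdGaussianE d)
    (σ : ℝ) (hσ0 : 0 < σ) (hσ : σ ^ 2 = 2 * γ * β⁻¹ * η) :
    P {ω | ∃ k : ℕ, Trec ≤ k * η ∧ k * η ≤ Tesc ∧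
        (ε * c / 3) ^ 2 ≤ uldQ T γ (uldG T γ η σ ξ k ω).1 (uldG T γ η σ ξ k ω).2} ≤
      ENNReal.ofReal δ := by
  set s := √(γ ^ 2 + M ^ 2 + 1) with hs
  have hs0 : 0 < s := Real.sqrt_pos.2 (by positivity)
  have hγs : γ ≤ s := Real.le_sqrt_of_sq_le (by nlinarith)
  set ℓ := d * Real.log 2 + Real.log ((6 * s * 𝒯 + 3) / δ) with hℓ
  have harg : 1 ≤ (6 * s * 𝒯 + 3) / δ := by
    rw [le_div_iff₀ hδ0]
    have : 0 < 6 * s * 𝒯 := by positivity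
    linarith
  have hℓ0 : 0 ≤ ℓ := by
    have h1 := Real.log_nonneg harg
    have h2 : 0 ≤ Real.log 2 := Real.log_nonneg (by norm_num)
    positivity
  set nb := ⌊1 / (2 * s) / η⌋₊ with hnb
  set k0 := ⌈Trec / η⌉₊ with hk0
  set K := ⌊Tesc / η⌋₊ with hK
  set J := ⌊2 * s * 𝒯⌋₊ + 1 with hJ
  set Θ := Real.exp (-(η * γ) + η ^ 2 * M) with hΘ
  have hΘ0 : 0 < Θ := Real.exp_pos _
  have hnbη : (nb : ℝ) * η ≤ 1 / (2 * s) := by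
    have := Nat.floor_le (a := 1 / (2 * s) / η) (by positivity)
    rwa [← hnb, le_div_iff₀ hη] at this
  have hnbη2 : 1 / (2 * s) ≤ ((nb : ℝ) + 1) * η := by
    have := (Nat.lt_floor_add_one (1 / (2 * s) / η)).le
    rwa [← hnb, div_le_iff₀ hη] at this
  let blk : ℕ → Set Ω := fun i => {ω | ∃ k, k0 + i * (nb + 1) ≤ k ∧ k ≤ min (k0 + i * (nb + 1) + nb) K ∧
    (ε * c / 3) ^ 2 ≤ uldQ T γ (uldG T γ η σ ξ k ω).1 (uldG T γ η σ ξ k ω).2}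
  have hsub : {ω | ∃ k : ℕ, Trec ≤ k * η ∧ k * η ≤ Tesc ∧
        (ε * c / 3) ^ 2 ≤ uldQ T γ (uldG T γ η σ ξ k ω).1 (uldG T γ η σ ξ k ω).2} ⊆
      ⋃ i ∈ Finset.range J, blk i := by
    rintro ω ⟨k, h1, h2, h3⟩
    have a1 : k0 ≤ k := by
      rw [hk0, Nat.ceil_le, div_le_iff₀ hη]; exact h1
    have a2 : k ≤ K := by
      rw [hK]; apply Nat.le_floor; rw [le_div_iff₀ hη]; exact h2
    have a3 : Trec ≤ k0 * η := by
      rw [← div_le_iff₀ hη]; exact Nat.le_ceil _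
    set i := (k - k0) / (nb + 1) with hi
    have b1 : i * (nb + 1) ≤ k - k0 := Nat.div_mul_le_self _ _
    have b2 : k - k0 < i * (nb + 1) + (nb + 1) := by
      have := Nat.lt_div_mul_add (a := k - k0) (b := nb + 1) (by omega)
      exact this
    have hi2 : i < J := by
      rw [hJ]
      refine Nat.lt_succ_of_le (Nat.le_floor ?_)
      have c1 : (i : ℝ) * (nb + 1) + k0 ≤ k := by
        have : i * (nb + 1) + k0 ≤ k := by omega
        exact_mod_cast this
      have c2 : (i : ℝ) * (1 / (2 * s)) ≤ i * (((nb : ℝ) + 1) * η) := by gcongr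
      have c3 : (i : ℝ) * (1 / (2 * s)) ≤ 𝒯 := by nlinarith
      have c4 : (i : ℝ) * (1 / (2 * s)) = i / (2 * s) := by ring
      rw [c4, div_le_iff₀ (by positivity)] at c3
      linarith
    simp only [Set.mem_iUnion]
    refine ⟨i, Finset.mem_range.2 hi2, k, by omega, ?_, h3⟩
    rw [le_min_iff]
    exact ⟨by omega, a2⟩
  have hblk : ∀ i, P (blk i) ≤ ENNReal.ofReal (δ / (6 * s * 𝒯 + 3)) := by
    intro i
    set n := min (k0 + i * (nb + 1) + nb) K with hn
    have hnT : (n : ℝ) * η ≤ Tesc := by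
      have h1 : (n : ℝ) ≤ K := by exact_mod_cast min_le_right _ _
      rw [← le_div_iff₀ hη]
      exact h1.trans (Nat.floor_le (by positivity))
    have hD : ∑ j ∈ Finset.range n, Θ ^ j ≤ 7 / 4 / (η * γ) :=
      uld_sum γ η M n hγ hη hM hηγ (hcase.imp (fun h => h n hnT) id)
    have hb := uld_noise_block P T γ m η σ Θ ξ hξmeas hξindep hξ hlow hγm hΘ0 hσ0
      (fun v y => by
        refine (uldQ_step T γ m M η hsym hlow hup hγm hmM v y).trans ?_
        refine mul_le_mul_of_nonneg_right ?_ (uldQ_nonneg T γ m hlow hγm v y)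
        have := Real.add_one_le_exp (-(η * γ) + η ^ 2 * M)
        linarith)
      n (k0 + i * (nb + 1)) (7 / 4 / (η * γ)) (Real.exp (1 / 2)) ((ε * c / 3) ^ 2) (by positivity)
      hD (by positivity)
      (fun k hk1 hk2 => by
        rw [hΘ, ← Real.exp_nat_mul, ← Real.exp_nat_mul, ← Real.exp_add, Real.exp_le_exp]
        have h1 : n ≤ k + nb := by
          have : n ≤ k0 + i * (nb + 1) + nb := min_le_left _ _
          omega
        have h2 : (n : ℝ) ≤ k + nb := by exact_mod_cast h1
        have h2' : (k : ℝ) ≤ n := by exact_mod_cast hk2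
        have h3 : ((n : ℝ) - k) * (η * γ) ≤ nb * (η * γ) := by gcongr; linarith
        have h4 : (nb : ℝ) * η * γ ≤ 1 / (2 * s) * s := by gcongr
        have h5 : 1 / (2 * s) * s = 1 / 2 := by field_simp
        have h6 : 0 ≤ ((n : ℝ) - k) * (η ^ 2 * M) := by
          have : 0 ≤ (n : ℝ) - k := by linarith
          positivity
        nlinarith)
      (Real.exp_pos _)
    refine hb.trans (ENNReal.ofReal_le_ofReal ?_)
    have hσD : 4 * σ ^ 2 * (7 / 4 / (η * γ)) * Real.exp (1 / 2) = 14 / β * Real.exp (1 / 2) := by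
      rw [hσ]; field_simp; norm_num
    have key : ℓ ≤ (ε * c / 3) ^ 2 / (4 * σ ^ 2 * (7 / 4 / (η * γ)) * Real.exp (1 / 2)) := by
      rw [hσD, le_div_iff₀ (by positivity)]
      have hE := uld_exp_half_le
      have h1 : 256 * C ^ 2 * ℓ ≤ β * ε ^ 2 := by
        have : 256 * C ^ 2 / ε ^ 2 * ℓ = 256 * C ^ 2 * ℓ / ε ^ 2 := by ring
        rw [this, div_le_iff₀ (by positivity)] at hβ
        exact hβ
      have h2 : 1 ≤ (C * c) ^ 2 := one_le_pow₀ hCc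
      have h3 : 256 * ℓ ≤ β * (ε * c) ^ 2 := by
        calc 256 * ℓ ≤ 256 * ℓ * (C * c) ^ 2 := le_mul_of_one_le_right (by positivity) h2
          _ = 256 * C ^ 2 * ℓ * c ^ 2 := by ring
          _ ≤ β * ε ^ 2 * c ^ 2 := by gcongr
          _ = _ := by ring
      calc ℓ * (14 / β * Real.exp (1 / 2)) ≤ ℓ * (14 / β * (33 / 20)) := by gcongr
        _ = (23.1 * ℓ) / β := by ring
        _ ≤ ((β * (ε * c) ^ 2) / 9) / β := by gcongr; linarith
        _ = _ := by field_simp; norm_num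
    calc 2 ^ d * Real.exp (-((ε * c / 3) ^ 2 / (4 * σ ^ 2 * (7 / 4 / (η * γ)) * Real.exp (1 / 2))))
        ≤ 2 ^ d * Real.exp (-ℓ) := by gcongr
      _ = δ / (6 * s * 𝒯 + 3) := by
        rw [hℓ, neg_add, Real.exp_add, Real.exp_neg (Real.log _), Real.exp_log (by positivity),
          Real.exp_neg, Real.exp_nat_mul, Real.exp_log (by norm_num)]
        field_simp
  calc _ ≤ P (⋃ i ∈ Finset.range J, blk i) := measure_mono hsub
    _ ≤ ∑ i ∈ Finset.range J, P (blk i) := measure_biUnion_finset_le _ _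
    _ ≤ ∑ i ∈ Finset.range J, ENNReal.ofReal (δ / (6 * s * 𝒯 + 3)) :=
        Finset.sum_le_sum fun i _ => hblk i
    _ = ENNReal.ofReal (J * (δ / (6 * s * 𝒯 + 3))) := by
        rw [Finset.sum_const, Finset.card_range, nsmul_eq_mul, ENNReal.ofReal_mul (by positivity),
          ENNReal.ofReal_natCast]
    _ ≤ ENNReal.ofReal δ := by
        refine ENNReal.ofReal_le_ofReal ?_
        have h1 : (J : ℝ) ≤ 2 * s * 𝒯 + 1 := by
          rw [hJ]; push_cast
          have := Nat.floor_le (a := 2 * s * 𝒯) (by positivity)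
          linarith
        calc (J : ℝ) * (δ / (6 * s * 𝒯 + 3)) ≤ (2 * s * 𝒯 + 1) * (δ / (6 * s * 𝒯 + 3)) := by gcongr
          _ = δ / 3 := by field_simp; ring
          _ ≤ δ := by linarith

set_option maxHeartbeats 2000000 in
/-- Recurrence/escape dichotomy for the underdamped Langevin dynamics
with small friction `0 < γ < 2√m`. -/
theorem uld_recurrence_escape_small_friction
    {Ω : Type*} [MeasurableSpace Ω] (P : Measure Ω) [IsProbabilityMeasure P]
    {d : ℕ} (hd : 1 ≤ d)
    -- the objective and its regularity
    (F : EuclideanSpace ℝ (Fin d) → ℝ) (hF : ContDiff ℝ 2 F)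
    (m b M L A B : ℝ)
    (hm : 0 < m) (hb : 0 < b) (hM : 0 < M) (hL : 0 < L) (hA : 0 < A) (hB : 0 < B)
    (hFlip : ∀ x y, ‖∇ F x - ∇ F y‖ ≤ M * ‖x - y‖)
    (hHlip : ∀ x y, ‖fderiv ℝ (∇ F) x - fderiv ℝ (∇ F) y‖ ≤ L * ‖x - y‖)
    (hF0 : |F 0| ≤ A) (hgrad0 : ‖∇ F 0‖ ≤ B)
    (hdiss : ∀ x, ⟪x, ∇ F x⟫ ≥ m * ‖x‖ ^ 2 - b)
    (R : ℝ) (hR : R = Real.sqrt (b / m))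
    -- the local minimum and its positive-definite Hessian with smallest eigenvalue m
    (xstar : EuclideanSpace ℝ (Fin d)) (hxstar : IsLocalMin F xstar)
    (H : Matrix (Fin d) (Fin d) ℝ)
    (hHdef : (Matrix.toEuclideanCLM (𝕜 := ℝ) H : EuclideanSpace ℝ (Fin d) →L[ℝ]
      EuclideanSpace ℝ (Fin d)) = fderiv ℝ (∇ F) xstar)
    (hH : H.PosDef)
    (hm_le : ∀ i, m ≤ hH.1.eigenvalues i) (hm_eq : ∃ i, hH.1.eigenvalues i = m)
    -- parameters: small friction
    (γ : ℝ) (hγ0 : 0 < γ) (hγ : γ < 2 * Real.sqrt m)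
    (εhat Cε : ℝ)
    (hεhat : εhat = 1 - γ / (2 * Real.sqrt m))
    (hCε : Cε = (1 + M) / Real.sqrt (m * (1 - (1 - εhat) ^ 2)))
    (δ r ε 𝒯 : ℝ) (hδ : 0 < δ ∧ δ < 1) (hr : 0 < r) (h𝒯 : 0 < 𝒯)
    -- the admissible range of ε
    (hε0 : 0 < ε)
    (hε : ε < min (Real.sqrt m * (1 - εhat) /
        (4 * Cε * L * (1 + 1 / (64 * Cε ^ 2)))) (8 * r * Cε))
    -- recurrence and escape times
    (Trec : ℝ)
    (hTrec : Trec = 2 / (Real.sqrt m * (1 - εhat)) * Real.log (8 * r * Cε / ε))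
    (Tesc : ℝ) (hTesc : Tesc = Trec + 𝒯)
    -- stepsize and inverse temperature
    (η β : ℝ) (hη0 : 0 < η) (hβ0 : 0 < β)
    -- auxiliary constants
    (lam Abar N Cxc Cvc Cvd K₁ K₂ : ℝ)
    (hlam : lam = min (1 / 8) (m / (2 * M + γ ^ 2)))
    (hAbar : Abar = β * m / (2 * M + γ ^ 2) *
      (B ^ 2 / (2 * M + γ ^ 2) + b / m * (M + γ ^ 2 / 2) + A))
    (hN : N = (β * M / 2 + β * γ ^ 2 * (2 - lam) / 4) * R ^ 2 + β * B * R + β * A)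
    (hCxc : Cxc = (N + (d + Abar) / lam) / (1 / 8 * (1 - 2 * lam) * β * γ ^ 2))
    (hCvc : Cvc = (N + (d + Abar) / lam) / (β / 4 * (1 - 2 * lam)))
    (hCvd : Cvd = (N + 4 * (d + Abar) / lam) / (β / 4 * (1 - 2 * lam)))
    (hK₁ : K₁ = max (32 * M ^ 2 * (1 / 2 + γ) / ((1 - 2 * lam) * β * γ ^ 2))
      (8 * (M / 2 + γ ^ 2 / 4 - γ ^ 2 * lam / 4 + γ) / (β * (1 - 2 * lam))))
    (hK₂ : K₂ = 2 * B ^ 2 * (1 / 2 + γ))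
    (hη : η ≤ min 1 (min (ε * Real.exp (-(1 + γ + M)) / (8 * B))
      (min (δ * ε ^ 2 * Real.exp (-2 * (1 + γ + M)) /
          (384 * (M ^ 2 * Cxc + (1 + γ) ^ 2 * Cvc) * Trec))
        (min (4 * γ * δ ^ 2 / (9 * β * M ^ 2 * Cvd * Tesc))
          (min (γ * (d + Abar) / (K₂ * β)) (γ * lam / (2 * K₁)))))))
    (hβ : β ≥ max
      (128 * γ * Cε ^ 2 / (Real.sqrt m * (1 - εhat) * ε ^ 2) *
        (d * Real.log 2 + Real.log ((6 * Real.sqrt (γ ^ 2 + M ^ 2 + 1) * 𝒯 + 3) / δ)))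
      (512 * d * γ * η *
          Real.log ((2 : ℝ) ^ ((1 : ℝ) / 4) * Real.exp ((1 : ℝ) / 4) * 6 * Trec / (δ * η)) /
        (ε ^ 2 * Real.exp (-2 * (1 + γ + M) * η))))
    -- i.i.d. standard Gaussian noise
    (ξ : ℕ → Ω → EuclideanSpace ℝ (Fin d)) (hξmeas : ∀ k, Measurable (ξ k))
    (hξindep : iIndepFun ξ P)
    (hξ : ∀ k, Measure.map (ξ k) P = stdGaussianE d)
    -- the ULD iterates
    (x0 : EuclideanSpace ℝ (Fin d)) (hx0R : ‖x0‖ ≤ R) (hx0r : ‖x0 - xstar‖ ≤ r)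
    (X V : ℕ → Ω → EuclideanSpace ℝ (Fin d))
    (hX0 : ∀ ω, X 0 ω = x0) (hV0 : ∀ ω, V 0 ω = 0)
    (hVrec : ∀ k ω, V (k + 1) ω =
      V k ω - η • (γ • V k ω + ∇ F (X k ω)) + Real.sqrt (2 * γ * β⁻¹ * η) • ξ k ω)
    (hXrec : ∀ k ω, X (k + 1) ω = X k ω + η • V k ω) :
    ENNReal.ofReal (1 - δ) ≤
      P {ω | (∃ k : ℕ, (k : ℝ) ≤ Trec / η ∧
            (1 / 2) * (ε + r * Real.exp (-(Real.sqrt m * (1 - εhat)) * (k * η))) ≤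
              ‖X k ω - xstar‖) ∨
          (∀ k : ℕ, Trec / η ≤ (k : ℝ) → (k : ℝ) ≤ Tesc / η →
            ‖X k ω - xstar‖ ≤ ε + r * Real.exp (-(Real.sqrt m * (1 - εhat)) * (k * η)))} := by
  obtain ⟨hδ0, hδ1⟩ := hδ
  have hsm : 0 < √m := Real.sqrt_pos.2 hm
  have hsm2 : √m ^ 2 = m := Real.sq_sqrt hm.le
  have h1e : 1 - εhat = γ / (2 * √m) := by rw [hεhat]; ring
  have hrate : √m * (1 - εhat) = γ / 2 := by rw [h1e]; field_simp
  have hγm : γ ^ 2 / 4 < m := by nlinarith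
  have hmm : m * (1 - (1 - εhat) ^ 2) = m - γ ^ 2 / 4 := by
    rw [h1e, div_pow, mul_pow, hsm2]; field_simp; ring
  rw [hmm] at hCε
  set c := √(m - γ ^ 2 / 4) with hcdef
  have hc : 0 < c := Real.sqrt_pos.2 (by linarith)
  have hc2 : c ^ 2 = m - γ ^ 2 / 4 := Real.sq_sqrt (by linarith)
  have hC : 0 < Cε := by rw [hCε]; positivity
  have hCc : Cε * c = 1 + M := by rw [hCε]; field_simp
  rw [hrate] at hε hTrec hβ
  simp only [hrate]
  obtain ⟨hε1, hε2⟩ := lt_min_iff.1 hε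
  have hεL : Cε * L * ε * (1 + 1 / (64 * Cε ^ 2)) ≤ γ / 8 := by
    rw [lt_div_iff₀ (by positivity)] at hε1
    linarith
  have hrC : 0 < 8 * r * Cε := by positivity
  have hE : ε / (8 * r * Cε) ≤ 1 := by rw [div_le_one hrC]; exact hε2.le
  have hlog : 0 < Real.log (8 * r * Cε / ε) := Real.log_pos (by rw [lt_div_iff₀ hε0]; linarith)
  have hTrec0 : 0 < Trec := by rw [hTrec]; positivity
  have hTesc0 : 0 < Tesc := by linarith
  have hTr : ∀ n : ℕ, Trec ≤ n * η → Real.exp (-(γ / 2) * (n * η)) ≤ (ε / (8 * r * Cε)) ^ 2 := by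
    intro n hn
    have h1 : γ / 2 * Trec ≤ γ / 2 * (n * η) := by gcongr
    have h2 : γ / 2 * Trec = 2 * Real.log (8 * r * Cε / ε) := by rw [hTrec]; field_simp
    calc Real.exp (-(γ / 2) * (n * η)) ≤ Real.exp (-(2 * Real.log (8 * r * Cε / ε))) :=
          Real.exp_le_exp.2 (by linarith)
      _ = (ε / (8 * r * Cε)) ^ 2 := by
        rw [two_mul, neg_add, Real.exp_add, Real.exp_neg, Real.exp_log (by positivity), ← sq, inv_div]
  -- the linearisation
  set T := fderiv ℝ (∇ F) xstar with hT
  have hsym : ∀ x y, ⟪T x, y⟫ = ⟪x, T y⟫ := by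
    rw [← hHdef]; exact uld_sym H hH.1
  have hlow : ∀ y, m * ‖y‖ ^ 2 ≤ ⟪y, T y⟫ := by
    rw [← hHdef]; exact uld_quad_lower H hH.1 m hm_le
  have hTn : ‖T‖ ≤ M := norm_fderiv_le_of_lip' ℝ hM.le (Filter.Eventually.of_forall fun x => hFlip x xstar)
  have hTy : ∀ y, ‖T y‖ ≤ M * ‖y‖ := fun y => T.le_of_opNorm_le hTn y
  have hup : ∀ y, ⟪y, T y⟫ ≤ M * ‖y‖ ^ 2 := by
    intro y
    have h1 := real_inner_le_norm y (T y)
    have h2 := mul_le_mul_of_nonneg_left (hTy y) (norm_nonneg y)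
    nlinarith
  have hmM : m ≤ M := by
    obtain ⟨i, _⟩ := hm_eq
    have h1 := hlow (EuclideanSpace.single i (1 : ℝ))
    have h2 := hup (EuclideanSpace.single i (1 : ℝ))
    have h3 : ‖EuclideanSpace.single i (1 : ℝ)‖ = 1 := by simp
    rw [h3] at h1 h2
    linarith
  have hgz : ∇ F xstar = 0 := uld_grad_zero F xstar hxstar
  have hf1 : ∀ x, ‖∇ F x - T (x - xstar)‖ ≤ L / 2 * ‖x - xstar‖ ^ 2 := fun x =>
    uld_taylor (∇ F) (uld_grad_diff F hF) L hHlip xstar x hgz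
  have hf2 : ∀ x, ‖∇ F x - T (x - xstar)‖ ≤ 2 * M * ‖x - xstar‖ := by
    intro x
    have h1 := hFlip x xstar
    rw [hgz, sub_zero] at h1
    have h2 := norm_sub_le (∇ F x) (T (x - xstar))
    have h3 := hTy (x - xstar)
    linarith
  -- the stepsize
  simp only [le_min_iff] at hη
  obtain ⟨hη1, _, _, hη4, _, _⟩ := hη
  have hlam0 : 0 < lam := by rw [hlam]; exact lt_min (by norm_num) (by positivity)
  have hlam1 : lam ≤ 1 / 8 := by rw [hlam]; exact min_le_left _ _
  have hd1 : (1 : ℝ) ≤ d := by exact_mod_cast hd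
  have hAbar0 : 0 ≤ Abar := by rw [hAbar]; positivity
  have hR0 : 0 ≤ R := by rw [hR]; positivity
  have hN0 : 0 ≤ N := by
    have : 0 ≤ 2 - lam := by linarith
    rw [hN]; positivity
  have hCvd1 : 128 ≤ β * Cvd := by
    have h0 : 0 < β / 4 * (1 - 2 * lam) := by
      have : 0 < 1 - 2 * lam := by linarith
      positivity
    have h1 : 32 ≤ N + 4 * (d + Abar) / lam := by
      have : 32 ≤ 4 * (d + Abar) / lam := by rw [le_div_iff₀ hlam0]; nlinarith
      linarith
    rw [hCvd, ← mul_div_assoc, le_div_iff₀ h0]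
    have h2 : β / 4 * (1 - 2 * lam) ≤ β / 4 := by nlinarith
    have h3 := mul_le_mul_of_nonneg_left h1 hβ0.le
    linarith
  have hCvd0 : 0 < Cvd := by
    by_contra h
    have := mul_nonpos_of_nonneg_of_nonpos hβ0.le (not_lt.1 h)
    linarith
  have hηT : η * M ^ 2 * Tesc ≤ γ / 288 := by
    rw [le_div_iff₀ (by positivity)] at hη4
    have h1 : 0 ≤ 9 * (η * M ^ 2 * Tesc) := by positivity
    have h2 := mul_le_mul_of_nonneg_left hCvd1 h1
    have h3 : δ ^ 2 ≤ 1 := pow_le_one₀ hδ0.le hδ1.le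
    have h4 : 4 * γ * δ ^ 2 ≤ 4 * γ * 1 := by gcongr
    clear hη1 hβ hε1 hε2 hN hAbar hCxc hCvc hCvd hK₁ hK₂
    linarith
  by_cases hTη : Tesc < η
  · have huniv : {ω | (∃ k : ℕ, (k : ℝ) ≤ Trec / η ∧
            (1 / 2) * (ε + r * Real.exp (-(γ / 2) * (k * η))) ≤ ‖X k ω - xstar‖) ∨
          (∀ k : ℕ, Trec / η ≤ (k : ℝ) → (k : ℝ) ≤ Tesc / η →
            ‖X k ω - xstar‖ ≤ ε + r * Real.exp (-(γ / 2) * (k * η)))} = Set.univ := by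
      refine Set.eq_univ_of_forall fun ω => Or.inr fun k hk1 hk2 => ?_
      exfalso
      have h1 : 0 < Trec / η := by positivity
      have h2 : Tesc / η < 1 := by rw [div_lt_one hη0]; exact hTη
      have h3 : (0 : ℝ) < k := by linarith
      have h4 : (k : ℝ) < 1 := by linarith
      norm_cast at h3 h4
      omega
    rw [huniv, measure_univ]
    exact ENNReal.ofReal_le_one.2 (by linarith)
  have hηTesc : η ≤ Tesc := not_lt.1 hTη
  have hηM : η ^ 2 * M ^ 2 ≤ γ / 288 := by
    refine le_trans ?_ hηT
    have := mul_le_mul_of_nonneg_left hηTesc (by positivity : 0 ≤ η * M ^ 2)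
    linarith
  have hηγ : η * γ ≤ 2 / 5 := by
    have h1 : γ ^ 2 ≤ 4 * M := by linarith
    have h2 : (γ ^ 2) ^ 2 ≤ (4 * M) ^ 2 := by gcongr
    have h3 : η ^ 2 * (γ ^ 2) ^ 2 ≤ η ^ 2 * (4 * M) ^ 2 := by gcongr
    have h4 : γ * (η ^ 2 * γ ^ 3) ≤ γ * (1 / 18) := by linarith
    have h5 : η ^ 2 * γ ^ 3 ≤ 1 / 18 := le_of_mul_le_mul_left h4 hγ0
    have h6 : η * (η ^ 2 * γ ^ 3) ≤ 1 * (η ^ 2 * γ ^ 3) := by gcongr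
    have h7 : (η * γ) ^ 3 ≤ (2 / 5) ^ 3 := by
      calc (η * γ) ^ 3 = η * (η ^ 2 * γ ^ 3) := by ring
        _ ≤ 1 / 18 := by linarith
        _ ≤ _ := by norm_num
    exact le_of_pow_le_pow_left₀ (by norm_num) (by norm_num) h7
  have hcase : (∀ n : ℕ, n * η ≤ Tesc → η * M * (n * η) ≤ 5 / 24) ∨ 60 * M ≤ γ := by
    by_cases h : 60 * M ≤ γ
    · exact Or.inr h
    · refine Or.inl fun n hn => ?_
      have h1 : η * M * (n * η) ≤ η * M * Tesc := by gcongr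
      have h2 : M * (η * M * Tesc) ≤ M * (5 / 24) := by
        have := not_le.1 h
        linarith
      exact h1.trans (le_of_mul_le_mul_left h2 hM)
  have hcase' : (∀ n : ℕ, n * η ≤ Tesc → η * M * (n * η) ≤ 5 / 24) ∨ η * M ≤ γ / 60 := by
    refine hcase.imp id fun h => ?_
    have : η * M ≤ 1 * M := by gcongr
    linarith
  -- the noise
  have hβ1 : 256 * Cε ^ 2 / ε ^ 2 * (d * Real.log 2 +
      Real.log ((6 * √(γ ^ 2 + M ^ 2 + 1) * 𝒯 + 3) / δ)) ≤ β := by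
    refine le_trans (le_of_eq ?_) ((le_max_left _ _).trans hβ)
    congr 1
    field_simp; norm_num
  have hσ0 : 0 < √(2 * γ * β⁻¹ * η) := Real.sqrt_pos.2 (by positivity)
  have hσ2 : √(2 * γ * β⁻¹ * η) ^ 2 = 2 * γ * β⁻¹ * η := Real.sq_sqrt (by positivity)
  set σ := √(2 * γ * β⁻¹ * η) with hσ
  have hbad := uld_noise_union P T γ m M η β c Cε ε δ 𝒯 Trec Tesc hsym hlow hup hγm hmM hγ0 hη0
    hβ0 hM hc hC hε0 hδ0 hδ1 h𝒯 hTesc0 hTesc hηγ hcase' (by linarith) hβ1 ξ hξmeas hξindep hξ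
    σ hσ0 hσ2
  set S := {ω | (∃ k : ℕ, (k : ℝ) ≤ Trec / η ∧
            (1 / 2) * (ε + r * Real.exp (-(γ / 2) * (k * η))) ≤ ‖X k ω - xstar‖) ∨
          (∀ k : ℕ, Trec / η ≤ (k : ℝ) → (k : ℝ) ≤ Tesc / η →
            ‖X k ω - xstar‖ ≤ ε + r * Real.exp (-(γ / 2) * (k * η)))} with hS
  set Bad := {ω | ∃ k : ℕ, Trec ≤ k * η ∧ k * η ≤ Tesc ∧
        (ε * c / 3) ^ 2 ≤ uldQ T γ (uldG T γ η σ ξ k ω).1 (uldG T γ η σ ξ k ω).2} with hBad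
  have hcover : (Set.univ : Set Ω) ⊆ S ∪ Bad := by
    intro ω _
    by_cases hωB : ω ∈ Bad
    · exact Or.inr hωB
    refine Or.inl ?_
    by_cases hω1 : ∃ k : ℕ, (k : ℝ) ≤ Trec / η ∧
            (1 / 2) * (ε + r * Real.exp (-(γ / 2) * (k * η))) ≤ ‖X k ω - xstar‖
    · exact Or.inl hω1
    refine Or.inr fun k hk1 hk2 => ?_
    rw [div_le_iff₀ hη0] at hk1
    rw [le_div_iff₀ hη0] at hk2
    have hfin := uld_path T γ m M L η c Cε ε r Trec Tesc hsym hlow hup hγm hmM hγ0 hη0 hη1 hM hL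
      hc hc2 hC hε0 hr hηγ hcase hεL hCc hTr hE (∇ F) xstar hf1 hf2 (fun k => X k ω)
      (fun k => V k ω) (fun k => σ • ξ k ω) (fun k => uldG T γ η σ ξ k ω) rfl (fun k => rfl)
      (hV0 ω) (by simpa [hX0 ω] using hx0r) (fun k => hVrec k ω) (fun k => hXrec k ω)
      (fun j hj => by
        by_contra hcon
        refine hω1 ⟨j, by rw [le_div_iff₀ hη0]; exact hj, ?_⟩
        have : 0 ≤ r * Real.exp (-(γ / 2) * (j * η)) := by positivity
        have := not_le.1 hcon
        linarith)
      (fun j hj1 hj2 => by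
        by_contra hcon
        exact hωB ⟨j, hj1, hj2, (not_le.1 hcon).le⟩)
      k hk1 hk2
    have : 0 ≤ r * Real.exp (-(γ / 2) * (k * η)) := by positivity
    have hfin' : ‖X k ω - xstar‖ ≤ ε := hfin
    linarith
  have hfinal : 1 ≤ P S + ENNReal.ofReal δ := by
    calc (1 : ℝ≥0∞) = P Set.univ := measure_univ.symm
      _ ≤ P (S ∪ Bad) := measure_mono hcover
      _ ≤ P S + P Bad := measure_union_le _ _
      _ ≤ _ := by gcongr
  rw [ENNReal.ofReal_sub _ hδ0.le, ENNReal.ofReal_one]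
  exact tsub_le_iff_right.2 hfinal

end
end

section
/- Let H be a d×d real symmetric positive definite matrix whose smallest eigenvalue is m > 0 and largest eigenvalue is M, and let H_γ be the 2d×2d block matrix [[γI, H],[−I, 0]]. If 0 < γ < 2√m, set ε̂ := 1 − γ/(2√m) ∈ (0,1) and C_ε̂ := (1+M)/√(m(1−(1−ε̂)²)). Then for every t ≥ 0, ‖e^{−tH_γ}‖ ≤ C_ε̂ · e^{−√m(1−ε̂)t}. -/
open Matrix

noncomputable section

/-- Matrix exponential. -/
def mexp {ι : Type*} [Fintype ι] [DecidableEq ι] (A : Matrix ι ι ℝ) : Matrix ι ι ℝ :=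
  NormedSpace.exp A

/-- Spectral norm (largest singular value) of a real matrix. -/
def specNorm {ι : Type*} [Fintype ι] [DecidableEq ι] (A : Matrix ι ι ℝ) : ℝ :=
  ‖Matrix.toEuclideanCLM (𝕜 := ℝ) A‖

theorem aux_semiconj {ι : Type*} [Fintype ι] [DecidableEq ι] (P A B : Matrix ι ι ℝ)
    (h : P * A = B * P) : P * NormedSpace.exp A = NormedSpace.exp B * P := by
  open scoped Matrix.Norms.Operator in
  exact SemiconjBy.exp_right (x := P) (a := A) (b := B) h

theorem aux_exp_scalar {ι : Type*} [Fintype ι] [DecidableEq ι] (c : ℝ) :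
    NormedSpace.exp (c • (1 : Matrix ι ι ℝ)) = Real.exp c • (1 : Matrix ι ι ℝ) := by
  rw [Matrix.smul_one_eq_diagonal, Matrix.smul_one_eq_diagonal, Matrix.exp_diagonal]
  congr 1
  funext i
  rw [Pi.coe_exp, Real.exp_eq_exp_ℝ]

theorem aux_conserve {ι : Type*} [Fintype ι] [DecidableEq ι] (P A : Matrix ι ι ℝ) (c : ℝ)
    (h : P * A + Aᵀ * P = -(c • P)) :
    (NormedSpace.exp A)ᵀ * P * NormedSpace.exp A = Real.exp (-c) • P := by
  have h1 : P * A = (-Aᵀ + (-c) • 1) * P := by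
    rw [eq_sub_of_add_eq h]
    simp [add_mul]
    abel
  have hc : Commute Aᵀ (-Aᵀ + (-c) • 1) :=
    (Commute.neg_right (Commute.refl _)).add_right ((Commute.one_right _).smul_right _)
  rw [mul_assoc, aux_semiconj _ _ _ h1, ← mul_assoc, ← Matrix.exp_transpose,
    ← Matrix.exp_add_of_commute _ _ hc, add_neg_cancel_left, aux_exp_scalar]
  simp

open scoped MatrixOrder in
theorem aux_lower {d : ℕ} (H : Matrix (Fin d) (Fin d) ℝ) (hH : H.IsHermitian) (m : ℝ)
    (hm : ∀ i, m ≤ hH.eigenvalues i) (y : Fin d → ℝ) : m * (y ⬝ᵥ y) ≤ y ⬝ᵥ (H *ᵥ y) := by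
  have h : algebraMap ℝ _ m ≤ H := by
    refine algebraMap_le_of_le_spectrum (fun x hx => ?_) hH.isSelfAdjoint
    rw [hH.spectrum_real_eq_range_eigenvalues] at hx
    obtain ⟨i, rfl⟩ := hx
    exact hm i
  have h2 := (Matrix.le_iff.1 h).dotProduct_mulVec_nonneg y
  simp only [Algebra.algebraMap_eq_smul_one, Matrix.sub_mulVec, Matrix.smul_mulVec,
    Matrix.one_mulVec, dotProduct_sub, dotProduct_smul, star_trivial, smul_eq_mul] at h2
  linarith

open scoped MatrixOrder in
theorem aux_upper {d : ℕ} (H : Matrix (Fin d) (Fin d) ℝ) (hH : H.IsHermitian) (m : ℝ)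
    (hm : ∀ i, hH.eigenvalues i ≤ m) (y : Fin d → ℝ) : y ⬝ᵥ (H *ᵥ y) ≤ m * (y ⬝ᵥ y) := by
  have h : H ≤ algebraMap ℝ _ m := by
    refine le_algebraMap_of_spectrum_le (fun x hx => ?_) hH.isSelfAdjoint
    rw [hH.spectrum_real_eq_range_eigenvalues] at hx
    obtain ⟨i, rfl⟩ := hx
    exact hm i
  have h2 := (Matrix.le_iff.1 h).dotProduct_mulVec_nonneg y
  simp only [Algebra.algebraMap_eq_smul_one, Matrix.sub_mulVec, Matrix.smul_mulVec,
    Matrix.one_mulVec, dotProduct_sub, dotProduct_smul, star_trivial, smul_eq_mul] at h2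
  linarith

theorem aux_Q {d : ℕ} (H : Matrix (Fin d) (Fin d) ℝ) (a : ℝ) (v : Fin d ⊕ Fin d → ℝ) :
    v ⬝ᵥ (Matrix.fromBlocks 1 (a • 1) (a • 1) H *ᵥ v) =
      (v ∘ Sum.inl) ⬝ᵥ (v ∘ Sum.inl) + 2 * a * ((v ∘ Sum.inl) ⬝ᵥ (v ∘ Sum.inr))
        + (v ∘ Sum.inr) ⬝ᵥ (H *ᵥ (v ∘ Sum.inr)) := by
  have hv : v = Sum.elim (v ∘ Sum.inl) (v ∘ Sum.inr) := by simp
  generalize v ∘ Sum.inl = x at *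
  generalize v ∘ Sum.inr = y at *
  subst hv
  rw [Matrix.fromBlocks_mulVec]
  simp only [Sum.elim_comp_inl, Sum.elim_comp_inr, sumElim_dotProduct_sumElim, Matrix.one_mulVec,
    Matrix.smul_mulVec, dotProduct_add, dotProduct_smul, smul_eq_mul]
  rw [dotProduct_comm y x]
  ring

theorem aux_N {d : ℕ} (v : Fin d ⊕ Fin d → ℝ) :
    v ⬝ᵥ v = (v ∘ Sum.inl) ⬝ᵥ (v ∘ Sum.inl) + (v ∘ Sum.inr) ⬝ᵥ (v ∘ Sum.inr) := by
  simp [dotProduct, Fintype.sum_sum_type]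

theorem aux_dot {d : ℕ} (x y : Fin d → ℝ) (p q r : ℝ) (hp : 0 < p) (hd : q ^ 2 ≤ p * r) :
    0 ≤ p * (x ⬝ᵥ x) + 2 * q * (x ⬝ᵥ y) + r * (y ⬝ᵥ y) := by
  simp only [dotProduct, Finset.mul_sum, ← Finset.sum_add_distrib]
  refine Finset.sum_nonneg fun i _ => ?_
  have h : 0 ≤ p * (p * (x i * x i) + 2 * q * (x i * y i) + r * (y i * y i)) := by
    nlinarith [sq_nonneg (p * x i + q * y i), mul_nonneg (sub_nonneg.2 hd) (sq_nonneg (y i))]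
  exact nonneg_of_mul_nonneg_right h hp

/-- Exponential decay of `‖e^{-tH_γ}‖` for `0 < γ < 2√m`. -/
theorem exp_block_matrix_norm_decay_small_gamma
    {d : ℕ} (hd : 1 ≤ d)
    (H : Matrix (Fin d) (Fin d) ℝ) (hH : H.PosDef)
    (m M : ℝ) (hm : 0 < m)
    (hm_le : ∀ i, m ≤ hH.1.eigenvalues i) (hm_eq : ∃ i, hH.1.eigenvalues i = m)
    (hM_le : ∀ i, hH.1.eigenvalues i ≤ M) (hM_eq : ∃ i, hH.1.eigenvalues i = M)
    (γ : ℝ) (hγ0 : 0 < γ) (hγ : γ < 2 * Real.sqrt m)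
    (εhat Cε : ℝ)
    (hεhat : εhat = 1 - γ / (2 * Real.sqrt m))
    (hCε : Cε = (1 + M) / Real.sqrt (m * (1 - (1 - εhat) ^ 2)))
    (Hγ : Matrix (Fin d ⊕ Fin d) (Fin d ⊕ Fin d) ℝ)
    (hHγ : Hγ = Matrix.fromBlocks (γ • 1) H (-1) 0) :
    ∀ t : ℝ, 0 ≤ t →
      specNorm (mexp (-(t • Hγ))) ≤ Cε * Real.exp (-(Real.sqrt m * (1 - εhat) * t)) := by
  intro t ht
  obtain ⟨i0, hi0⟩ := hm_eq
  have hmM : m ≤ M := hi0 ▸ hM_le i0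
  set s := Real.sqrt m with hs
  have hs0 : 0 < s := Real.sqrt_pos.2 hm
  have hss : s * s = m := Real.mul_self_sqrt hm.le
  set a := γ / 2 with ha
  have hγa : γ = 2 * a := by rw [ha]; ring
  have ha0 : 0 < a := by rw [ha]; linarith
  have has : a < s := by rw [ha]; linarith
  have ham : a ^ 2 < m := by nlinarith
  have he1 : 1 - εhat = a / s := by rw [hεhat, hγa]; field_simp; ring
  have he2 : s * (1 - εhat) = a := by rw [he1]; field_simp
  have he3 : m * (1 - (1 - εhat) ^ 2) = m - a ^ 2 := by
    have : m * (1 - εhat) ^ 2 = (s * (1 - εhat)) ^ 2 := by rw [← hss]; ring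
    rw [mul_sub, this, he2]; ring
  rw [he3] at hCε
  rw [he2]
  have hw : 0 < m - a ^ 2 := by linarith
  have hC0 : 0 ≤ Cε := by rw [hCε]; have : 0 ≤ 1 + M := by linarith
                          positivity
  have hC2 : Cε ^ 2 * (m - a ^ 2) = (1 + M) ^ 2 := by
    rw [hCε, div_pow, Real.sq_sqrt hw.le]; field_simp
  set P : Matrix (Fin d ⊕ Fin d) (Fin d ⊕ Fin d) ℝ := Matrix.fromBlocks 1 (a • 1) (a • 1) H with hP
  have hHT : Hᵀ = H := by simpa [Matrix.IsHermitian] using hH.1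
  have hcomm : P * (-(t • Hγ)) + (-(t • Hγ))ᵀ * P = -((2 * a * t) • P) := by
    have h0 : P * Hγ + Hγᵀ * P = (2 * a) • P := by
      rw [hHγ, hP, hγa, Matrix.fromBlocks_transpose, hHT, Matrix.fromBlocks_multiply,
        Matrix.fromBlocks_multiply, Matrix.fromBlocks_add, Matrix.fromBlocks_smul]
      simp only [Matrix.transpose_smul, Matrix.transpose_one, Matrix.transpose_neg,
        Matrix.transpose_zero]
      congr 1 <;> simp [smul_smul] <;> module
    have : P * (-(t • Hγ)) + (-(t • Hγ))ᵀ * P = -(t • (P * Hγ + Hγᵀ * P)) := by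
      simp
      abel
    rw [this, h0, smul_smul, mul_comm t]
  have hcons := aux_conserve P _ _ hcomm
  unfold specNorm mexp
  set E := NormedSpace.exp (-(t • Hγ)) with hE
  refine ContinuousLinearMap.opNorm_le_bound _ (by positivity) fun v => ?_
  have hn : ∀ w : EuclideanSpace ℝ (Fin d ⊕ Fin d), ‖w‖ ^ 2 = w.ofLp ⬝ᵥ w.ofLp := by
    intro w
    rw [EuclideanSpace.real_norm_sq_eq]
    simp [dotProduct, sq]
  have hlow : ∀ w : Fin d ⊕ Fin d → ℝ, (m - a ^ 2) * (w ⬝ᵥ w) ≤ (1 + m) * (w ⬝ᵥ (P *ᵥ w)) := by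
    intro w
    rw [hP, aux_Q, aux_N]
    have h1 := aux_lower H hH.1 m hm_le (w ∘ Sum.inr)
    have h2 := aux_dot (w ∘ Sum.inl) (w ∘ Sum.inr) (1 + a ^ 2) (a * (1 + m)) (m ^ 2 + a ^ 2)
      (by positivity) (by nlinarith [sq_nonneg (m - a ^ 2)])
    nlinarith [mul_le_mul_of_nonneg_left h1 (by linarith : 0 ≤ 1 + m)]
  have hup : ∀ w : Fin d ⊕ Fin d → ℝ, w ⬝ᵥ (P *ᵥ w) ≤ (1 + M) * (w ⬝ᵥ w) := by
    intro w
    rw [hP, aux_Q, aux_N]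
    have h1 := aux_upper H hH.1 M hM_le (w ∘ Sum.inr)
    have h2 := aux_dot (w ∘ Sum.inl) (w ∘ Sum.inr) M (-a) 1 (by linarith) (by nlinarith)
    nlinarith
  have hQ : ∀ w : Fin d ⊕ Fin d → ℝ,
      (E *ᵥ w) ⬝ᵥ (P *ᵥ (E *ᵥ w)) = Real.exp (-(2 * a * t)) * (w ⬝ᵥ (P *ᵥ w)) := by
    intro w
    have := congrArg (fun X => w ⬝ᵥ (X *ᵥ w)) hcons
    simp only [Matrix.smul_mulVec, dotProduct_smul, smul_eq_mul] at this
    rw [← this, ← Matrix.mulVec_mulVec, ← Matrix.mulVec_mulVec, Matrix.dotProduct_mulVec w Eᵀ,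
      Matrix.vecMul_transpose]
  have hexp : Real.exp (-(2 * a * t)) = Real.exp (-(a * t)) ^ 2 := by
    rw [← Real.exp_nat_mul]; congr 1; push_cast; ring
  refine (sq_le_sq₀ (by positivity) (by positivity)).1 ?_
  rw [mul_pow, mul_pow, hn, hn, Matrix.ofLp_toEuclideanCLM, ← hexp]
  generalize v.ofLp = w
  have k1 := hlow (E *ᵥ w)
  rw [hQ] at k1
  have hN : 0 ≤ w ⬝ᵥ w := by simpa using dotProduct_star_self_nonneg w
  have he := Real.exp_pos (-(2 * a * t))
  refine le_of_mul_le_mul_left ?_ hw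
  calc _ ≤ _ := k1
    _ ≤ (1 + m) * (Real.exp (-(2 * a * t)) * ((1 + M) * (w ⬝ᵥ w))) := by
        have : 0 ≤ 1 + m := by linarith
        gcongr
        exact hup w
    _ ≤ (1 + M) * (Real.exp (-(2 * a * t)) * ((1 + M) * (w ⬝ᵥ w))) := by
        have : 0 ≤ 1 + M := by linarith
        gcongr
    _ = (Cε ^ 2 * (m - a ^ 2)) * Real.exp (-(2 * a * t)) * (w ⬝ᵥ w) := by rw [hC2]; ring
    _ = _ := by ring

end
end

section
/- Let H be a d×d real symmetric positive definite matrix whose smallest eigenvalue is m > 0, and let H_γ be the 2d×2d block matrix [[γI, H],[−I, 0]] with γ = 2√m. Let C_H := the maximum of (1+λ)²/(λ−m) over all eigenvalues λ of H with λ > m (C_H := 0 if no eigenvalue of H exceeds m). Then for every t ≥ 0, ‖e^{−tH_γ}‖ ≤ √(C_H + 2 + (m+1)²t²) · e^{−√m·t}. -/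
open Matrix

noncomputable section

/-- Uniqueness for the linear matrix equation. -/
theorem exp_eq_of_deriv {A : Type*} [NormedRing A] [NormedAlgebra ℝ A] [CompleteSpace A]
    (X : A) (G : ℝ → A) (h0 : G 0 = 1) (hG : ∀ t, HasDerivAt G (X * G t) t) (t : ℝ) :
    NormedSpace.exp (t • X) = G t := by
  let _ : NormedAlgebra ℚ A := NormedAlgebra.restrictScalars ℚ ℝ A
  have hd : ∀ u : ℝ, HasDerivAt (fun u : ℝ => NormedSpace.exp (u • (-X)) * G u) 0 u := by
    intro u
    have h := (hasDerivAt_exp_smul_const (𝕂 := ℝ) (-X) u).mul (hG u)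
    refine h.congr_deriv ?_
    noncomm_ring
  have hc : NormedSpace.exp (t • (-X)) * G t = 1 := by
    have := is_const_of_deriv_eq_zero (fun u => (hd u).differentiableAt)
      (fun u => (hd u).deriv) t 0
    simpa [h0] using this
  have hinv : NormedSpace.exp (t • X) * NormedSpace.exp (t • (-X)) = 1 := by
    rw [← NormedSpace.exp_add_of_commute]
    · simp
    · simp [Commute, SemiconjBy]
  calc NormedSpace.exp (t • X) = NormedSpace.exp (t • X) * (NormedSpace.exp (t • (-X)) * G t) := by
        rw [hc, mul_one]
    _ = G t := by rw [← mul_assoc, hinv, one_mul]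

theorem exists_cos_sin (k : ℝ) (hk : 0 ≤ k) : ∃ c s : ℝ → ℝ,
    c 0 = 1 ∧ s 0 = 0 ∧ (∀ t, HasDerivAt c (-(k * s t)) t) ∧ (∀ t, HasDerivAt s (c t) t) ∧
    (∀ t, c t ^ 2 + k * s t ^ 2 = 1) ∧ (k = 0 → ∀ t, s t = t) := by
  rcases hk.eq_or_lt with rfl | hk
  · refine ⟨fun _ => 1, fun t => t, rfl, rfl, ?_, ?_, ?_, ?_⟩
    · intro t; simpa using hasDerivAt_const t (1 : ℝ)
    · intro t; exact hasDerivAt_id t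
    · intro t; simp
    · intro _ t; rfl
  · have hw : 0 < Real.sqrt k := Real.sqrt_pos.2 hk
    have hsq : Real.sqrt k ^ 2 = k := Real.sq_sqrt hk.le
    generalize Real.sqrt k = w at hw hsq
    subst hsq
    have hl : ∀ t, HasDerivAt (fun t : ℝ => w * t) w t := fun t => by
      simpa using (hasDerivAt_id t).const_mul w
    refine ⟨fun t => Real.cos (w * t), fun t => Real.sin (w * t) / w, by simp, by simp,
      ?_, ?_, ?_, ?_⟩
    · intro t
      refine HasDerivAt.congr_deriv ((hl t).cos) ?_
      field_simp
    · intro t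
      refine HasDerivAt.congr_deriv ((hl t).sin.div_const w) ?_
      field_simp
    · intro t
      have := Real.sin_sq_add_cos_sq (w * t)
      field_simp
      linarith
    · intro h; exact absurd h hk.ne'

open scoped Matrix.Norms.Operator in
theorem exp_matrix_eq_of_deriv {n : Type*} [Fintype n] [DecidableEq n]
    (X : Matrix n n ℝ) (G : ℝ → Matrix n n ℝ) (h0 : G 0 = 1)
    (hG : ∀ t i j, HasDerivAt (fun u => G u i j) ((X * G t) i j) t) (t : ℝ) :
    NormedSpace.exp (t • X) = G t := by
  refine exp_eq_of_deriv X G h0 (fun u => ?_) t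
  exact hasDerivAt_pi.2 fun i => hasDerivAt_pi.2 fun j => hG u i j

theorem exp_diag_blocks {n : Type*} [Fintype n] [DecidableEq n] (l : n → ℝ) (r : ℝ)
    (c s : n → ℝ → ℝ) (hc0 : ∀ i, c i 0 = 1) (hs0 : ∀ i, s i 0 = 0)
    (hc : ∀ i t, HasDerivAt (c i) (-((l i - r ^ 2) * s i t)) t)
    (hs : ∀ i t, HasDerivAt (s i) (c i t) t) (t : ℝ) :
    NormedSpace.exp (t • (fromBlocks (diagonal fun _ => -(2 * r)) (diagonal fun i => -l i)
      (diagonal fun _ => 1) (diagonal fun _ => 0) : Matrix (n ⊕ n) (n ⊕ n) ℝ)) =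
    fromBlocks (diagonal fun i => Real.exp (-(r * t)) * (c i t - r * s i t))
      (diagonal fun i => Real.exp (-(r * t)) * (-(l i * s i t)))
      (diagonal fun i => Real.exp (-(r * t)) * (s i t))
      (diagonal fun i => Real.exp (-(r * t)) * (c i t + r * s i t)) := by
  refine exp_matrix_eq_of_deriv _ (fun t => fromBlocks
      (diagonal fun i => Real.exp (-(r * t)) * (c i t - r * s i t))
      (diagonal fun i => Real.exp (-(r * t)) * (-(l i * s i t)))
      (diagonal fun i => Real.exp (-(r * t)) * (s i t))
      (diagonal fun i => Real.exp (-(r * t)) * (c i t + r * s i t))) ?_ ?_ t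
  · simp [hc0, hs0]
  · intro t
    have he : HasDerivAt (fun t : ℝ => Real.exp (-(r * t))) (Real.exp (-(r * t)) * (-r)) t := by
      have : HasDerivAt (fun t : ℝ => -(r * t)) (-r) t := by
        exact (((hasDerivAt_id t).const_mul r).neg).congr_deriv (by simp)
      exact this.exp
    simp only [fromBlocks_multiply, diagonal_mul_diagonal, diagonal_add]
    rintro (i | i) (j | j)
    all_goals
      simp only [fromBlocks_apply₁₁, fromBlocks_apply₁₂, fromBlocks_apply₂₁, fromBlocks_apply₂₂]
      by_cases hij : i = j
      swap
      · simp only [diagonal_apply_ne _ hij]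
        exact hasDerivAt_const _ _
      subst hij
      simp only [diagonal_apply_eq]
    · refine HasDerivAt.congr_deriv (he.mul ((hc i t).sub ((hs i t).const_mul r))) ?_
      ring
    · refine HasDerivAt.congr_deriv (he.mul (((hs i t).const_mul (l i)).neg)) ?_
      ring
    · refine HasDerivAt.congr_deriv (he.mul (hs i t)) ?_
      ring
    · refine HasDerivAt.congr_deriv (he.mul ((hc i t).add ((hs i t).const_mul r))) ?_
      ring

theorem norm_diag_blocks_le {n : Type*} [Fintype n] [DecidableEq n] (a b c e : n → ℝ) (B : ℝ)
    (hB : 0 ≤ B) (h : ∀ i, a i ^ 2 + b i ^ 2 + c i ^ 2 + e i ^ 2 ≤ B ^ 2) :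
    ‖Matrix.toEuclideanCLM (𝕜 := ℝ) (fromBlocks (diagonal a) (diagonal b) (diagonal c)
      (diagonal e) : Matrix (n ⊕ n) (n ⊕ n) ℝ)‖ ≤ B := by
  refine ContinuousLinearMap.opNorm_le_bound _ hB fun v => ?_
  refine le_of_sq_le_sq ?_ (by positivity)
  rw [mul_pow, EuclideanSpace.real_norm_sq_eq, EuclideanSpace.real_norm_sq_eq,
    Fintype.sum_sum_type, Fintype.sum_sum_type, ← Finset.sum_add_distrib,
    ← Finset.sum_add_distrib, Finset.mul_sum]
  refine Finset.sum_le_sum fun i _ => ?_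
  have e1 : (Matrix.toEuclideanCLM (𝕜 := ℝ) (fromBlocks (diagonal a) (diagonal b) (diagonal c)
      (diagonal e) : Matrix (n ⊕ n) (n ⊕ n) ℝ)) v (Sum.inl i)
      = a i * v (Sum.inl i) + b i * v (Sum.inr i) := by
    rw [Matrix.ofLp_toEuclideanCLM]
    simp [fromBlocks_mulVec, mulVec_diagonal]
  have e2 : (Matrix.toEuclideanCLM (𝕜 := ℝ) (fromBlocks (diagonal a) (diagonal b) (diagonal c)
      (diagonal e) : Matrix (n ⊕ n) (n ⊕ n) ℝ)) v (Sum.inr i)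
      = c i * v (Sum.inl i) + e i * v (Sum.inr i) := by
    rw [Matrix.ofLp_toEuclideanCLM]
    simp [fromBlocks_mulVec, mulVec_diagonal]
  rw [e1, e2]
  generalize v (Sum.inl i) = x
  generalize v (Sum.inr i) = y
  have h1 := mul_le_mul_of_nonneg_right (h i) (by positivity : 0 ≤ x ^ 2 + y ^ 2)
  nlinarith [sq_nonneg (a i * y - b i * x), sq_nonneg (c i * y - e i * x)]

open scoped Matrix.Norms.L2Operator in
theorem specNorm_conj {n : Type*} [Fintype n] [DecidableEq n] (W A : Matrix n n ℝ)
    (hW : W ∈ unitary (Matrix n n ℝ)) : specNorm (W * A * star W) = specNorm A := by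
  change ‖W * A * star W‖ = ‖A‖
  rw [CStarRing.norm_mul_mem_unitary _ (Unitary.star_mem hW), CStarRing.norm_mem_unitary_mul _ hW]

/-- Decay of `‖e^{-tH_γ}‖` in the critical regime `γ = 2√m`. -/
theorem exp_block_matrix_norm_decay_critical_gamma
    {d : ℕ} (hd : 1 ≤ d)
    (H : Matrix (Fin d) (Fin d) ℝ) (hH : H.PosDef)
    (m : ℝ) (hm : 0 < m)
    (hm_le : ∀ i, m ≤ hH.1.eigenvalues i) (hm_eq : ∃ i, hH.1.eigenvalues i = m)
    (γ : ℝ) (hγ : γ = 2 * Real.sqrt m)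
    -- C_H: the max of (1+λ)²/(λ-m) over eigenvalues λ > m, and 0 if there is none
    (CH : ℝ)
    (hCH_le : ∀ i, m < hH.1.eigenvalues i →
      (1 + hH.1.eigenvalues i) ^ 2 / (hH.1.eigenvalues i - m) ≤ CH)
    (hCH_eq : (∃ i, m < hH.1.eigenvalues i) → ∃ i, m < hH.1.eigenvalues i ∧
      CH = (1 + hH.1.eigenvalues i) ^ 2 / (hH.1.eigenvalues i - m))
    (hCH_zero : (¬ ∃ i, m < hH.1.eigenvalues i) → CH = 0)
    (Hγ : Matrix (Fin d ⊕ Fin d) (Fin d ⊕ Fin d) ℝ)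
    (hHγ : Hγ = Matrix.fromBlocks (γ • 1) H (-1) 0) :
    ∀ t : ℝ, 0 ≤ t →
      specNorm (mexp (-(t • Hγ))) ≤
        Real.sqrt (CH + 2 + (m + 1) ^ 2 * t ^ 2) * Real.exp (-(Real.sqrt m * t)) := by
  intro t _
  set l := hH.1.eigenvalues with hl
  set r := Real.sqrt m with hr
  have hr2 : r ^ 2 = m := Real.sq_sqrt hm.le
  have hk : ∀ i, 0 ≤ l i - r ^ 2 := fun i => by rw [hr2]; linarith [hm_le i]
  choose c s hc0 hs0 hc hs hcs hs1 using fun i => exists_cos_sin (l i - r ^ 2) (hk i)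
  have hCH0 : 0 ≤ CH := by
    by_cases h : ∃ i, m < l i
    · obtain ⟨i, hi⟩ := h
      refine le_trans ?_ (hCH_le i hi)
      have : 0 < l i - m := by linarith
      positivity
    · exact (hCH_zero h).ge
  obtain ⟨U, hU, hUH⟩ : ∃ U ∈ unitary (Matrix (Fin d) (Fin d) ℝ),
      H = U * diagonal l * star U := by
    refine ⟨hH.1.eigenvectorUnitary, hH.1.eigenvectorUnitary.2, ?_⟩
    have := hH.1.spectral_theorem
    rw [Unitary.conjStarAlgAut_apply] at this
    exact this
  have hU1 : star U * U = 1 := (Unitary.mem_iff.1 hU).1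
  have hU2 : U * star U = 1 := (Unitary.mem_iff.1 hU).2
  set W : Matrix (Fin d ⊕ Fin d) (Fin d ⊕ Fin d) ℝ := fromBlocks U 0 0 U with hWdef
  have hWs : star W = fromBlocks (star U) 0 0 (star U) := by
    rw [hWdef, star_eq_conjTranspose, fromBlocks_conjTranspose]
    simp [star_eq_conjTranspose]
  have hW1 : star W * W = 1 := by
    rw [hWs, hWdef, fromBlocks_multiply]; simp [hU1]
  have hW2 : W * star W = 1 := by
    rw [hWs, hWdef, fromBlocks_multiply]; simp [hU2]
  have hW : W ∈ unitary (Matrix (Fin d ⊕ Fin d) (Fin d ⊕ Fin d) ℝ) :=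
    Unitary.mem_iff.2 ⟨hW1, hW2⟩
  set X : Matrix (Fin d ⊕ Fin d) (Fin d ⊕ Fin d) ℝ :=
    fromBlocks (diagonal fun _ => -(2 * r)) (diagonal fun i => -l i)
      (diagonal fun _ => 1) (diagonal fun _ => 0) with hX
  have hd1 : (diagonal fun _ : Fin d => -(2 * r)) = (-(2 * r)) • (1 : Matrix (Fin d) (Fin d) ℝ) := by
    rw [smul_one_eq_diagonal]
  have hd2 : (diagonal fun i : Fin d => - l i) = -diagonal l := by
    rw [diagonal_neg]
  have hconj : -(t • Hγ) = W * (t • X) * star W := by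
    have : -Hγ = W * X * star W := by
      rw [hWs, hWdef, hX, fromBlocks_multiply, fromBlocks_multiply, hHγ, fromBlocks_neg, hd1, hd2,
        hγ]
      congr 1
      · simp [hU2]
      · simp [hUH, -diagonal_neg]
      · simp [hU2]
      · simp
    rw [mul_smul_comm, smul_mul_assoc, ← this, smul_neg]
  have hinv : W⁻¹ = star W := Matrix.inv_eq_right_inv hW2
  have hexp : mexp (-(t • Hγ)) = W * NormedSpace.exp (t • X) * star W := by
    unfold mexp
    rw [hconj, ← hinv]
    exact Matrix.exp_conj W _ (IsUnit.of_mul_eq_one _ hW2)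
  rw [hexp, specNorm_conj W _ hW, hX, exp_diag_blocks l r c s hc0 hs0 hc hs t]
  refine norm_diag_blocks_le _ _ _ _ _ (by positivity) fun i => ?_
  have hpos : 0 ≤ CH + 2 + (m + 1) ^ 2 * t ^ 2 := by positivity
  rw [mul_pow (Real.sqrt _), Real.sq_sqrt hpos]
  rw [mul_pow, mul_pow (Real.exp _), mul_pow (Real.exp _), mul_pow (Real.exp _)]
  rw [← mul_add, ← mul_add, ← mul_add, mul_comm]
  refine mul_le_mul_of_nonneg_right ?_ (by positivity)
  have h1 := hcs i t
  have key : (c i t - r * s i t) ^ 2 + (-(l i * s i t)) ^ 2 + s i t ^ 2 + (c i t + r * s i t) ^ 2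
      = 2 - 4 * ((l i - r ^ 2) * s i t ^ 2) + (1 + l i) ^ 2 * s i t ^ 2 := by
    linear_combination 2 * h1
  have key2 : (1 + l i) ^ 2 * s i t ^ 2 ≤ CH + (m + 1) ^ 2 * t ^ 2 := by
    rcases (hm_le i).eq_or_lt with h | h
    · rw [hs1 i (by rw [hr2, h, sub_self]) t, ← h, add_comm 1 m]
      linarith
    · have hp : 0 < l i - m := by linarith
      have h2 := (div_le_iff₀ hp).1 (hCH_le i h)
      have h3 := mul_le_mul_of_nonneg_right h2 (sq_nonneg (s i t))
      have h4 : (l i - m) * s i t ^ 2 ≤ 1 := by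
        rw [hr2] at h1; linarith [sq_nonneg (c i t)]
      have h5 := mul_le_mul_of_nonneg_left h4 hCH0
      have h6 : 0 ≤ (m + 1) ^ 2 * t ^ 2 := by positivity
      linarith
  have h7 := mul_nonneg (hk i) (sq_nonneg (s i t))
  linarith

end
end

section
/- Let F : ℝ^d → ℝ be nonnegative and continuously differentiable, with ‖∇F(x) − ∇F(y)‖ ≤ M‖x−y‖ for all x,y, ⟨x, ∇F(x)⟩ ≥ m‖x‖² − b for all x, and F(x) ≤ (M/2)‖x‖² + B‖x‖ + A for all x, where m, b, M, B, A > 0. Let J be a d×d real antisymmetric matrix, A_J := I + J, and let β > 0 and 0 < η ≤ 1/(M‖A_J‖²). Define X₀ = x ∈ ℝ^d and X_{k+1} = X_k − ηA_J∇F(X_k) + √(2ηβ^{−1})ξ_k, where (ξ_k)_{k≥0} are i.i.d. standard Gaussian random vectors in ℝ^d. Then for every k ≥ 0: E[F(X_k)] ≤ F(x) + B/2 + A + 4(M+B)Mβ^{−1}d/m² + (M+B)b/m. -/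
open MeasureTheory ProbabilityTheory Matrix
open scoped RealInnerProductSpace ENNReal NNReal
open Gradient

noncomputable section
lemma stdGaussianE_eq (d : ℕ) : stdGaussianE d = stdGaussian (EuclideanSpace ℝ (Fin d)) := by
  rw [← map_pi_eq_stdGaussian]; rfl

lemma integral_norm_sq_stdGaussian (d : ℕ) :
    ∫ y, ‖y‖ ^ 2 ∂(stdGaussian (EuclideanSpace ℝ (Fin d))) = d := by
  have h2 : MemLp id 2 (stdGaussian (EuclideanSpace ℝ (Fin d))) := IsGaussian.memLp_two_id
  have hi : ∀ i : Fin d, MemLp (fun y : EuclideanSpace ℝ (Fin d) => y i) 2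
      (stdGaussian (EuclideanSpace ℝ (Fin d))) := fun i =>
    h2.continuousLinearMap_comp (EuclideanSpace.proj i : EuclideanSpace ℝ (Fin d) →L[ℝ] ℝ)
  have hv : ∀ i : Fin d, ∫ y, (y i) ^ 2 ∂(stdGaussian (EuclideanSpace ℝ (Fin d))) = 1 := by
    intro i
    have h := variance_dual_stdGaussian (E := EuclideanSpace ℝ (Fin d))
      (innerSL ℝ (EuclideanSpace.single i (1 : ℝ)))
    have h0 := integral_strongDual_stdGaussian (E := EuclideanSpace ℝ (Fin d))
      (innerSL ℝ (EuclideanSpace.single i (1 : ℝ)))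
    rw [variance_of_integral_eq_zero (by fun_prop) h0, innerSL_apply_norm] at h
    simpa [innerSL_apply_apply, EuclideanSpace.inner_single_left] using h
  simp_rw [EuclideanSpace.norm_sq_eq, Real.norm_eq_abs, sq_abs]
  rw [integral_finsetSum _ fun i _ => (hi i).integrable_sq]
  simp [hv]

lemma descent {d : ℕ} (F : EuclideanSpace ℝ (Fin d) → ℝ) (hF : ContDiff ℝ 1 F) (M : ℝ)
    (hlip : ∀ x y, ‖∇ F x - ∇ F y‖ ≤ M * ‖x - y‖) (x v : EuclideanSpace ℝ (Fin d)) :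
    F (x + v) ≤ F x + ⟪∇ F x, v⟫ + M / 2 * ‖v‖ ^ 2 := by
  have hd : ∀ t : ℝ, HasDerivAt
      (fun t : ℝ => F (x + t • v) - t * ⟪∇ F x, v⟫ - M / 2 * ‖v‖ ^ 2 * t ^ 2)
      (⟪∇ F (x + t • v), v⟫ - ⟪∇ F x, v⟫ - M * ‖v‖ ^ 2 * t) t := by
    intro t
    have h1 : HasFDerivAt F (InnerProductSpace.toDual ℝ _ (∇ F (x + t • v))) (x + t • v) :=
      ((hF.differentiable (by norm_num)) _).hasGradientAt.hasFDerivAt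
    have h2 : HasDerivAt (fun t : ℝ => x + t • v) v t := by
      simpa using ((hasDerivAt_id t).smul_const v).const_add x
    have h3 := h1.comp_hasDerivAt t h2
    have h4 := (h3.sub ((hasDerivAt_id t).mul_const ⟪∇ F x, v⟫)).sub
      ((hasDerivAt_pow 2 t).const_mul (M / 2 * ‖v‖ ^ 2))
    refine h4.congr_deriv ?_
    simp
    ring
  have hanti : AntitoneOn
      (fun t : ℝ => F (x + t • v) - t * ⟪∇ F x, v⟫ - M / 2 * ‖v‖ ^ 2 * t ^ 2) (Set.Icc 0 1) := by
    refine antitoneOn_of_deriv_nonpos (convex_Icc 0 1)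
      (fun t _ => (hd t).continuousAt.continuousWithinAt)
      (fun t _ => (hd t).differentiableAt.differentiableWithinAt) ?_
    intro t ht
    rw [interior_Icc] at ht
    rw [(hd t).deriv, ← inner_sub_left]
    have h1 := real_inner_le_norm (∇ F (x + t • v) - ∇ F x) v
    have h2 := hlip (x + t • v) x
    rw [add_sub_cancel_left, norm_smul, Real.norm_eq_abs, abs_of_pos ht.1] at h2
    nlinarith [norm_nonneg v, mul_le_mul_of_nonneg_right h2 (norm_nonneg v)]
  have := hanti (Set.left_mem_Icc.2 zero_le_one) (Set.right_mem_Icc.2 zero_le_one) zero_le_one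
  simp at this ⊢
  linarith

lemma inner_AJ {d : ℕ} (J : Matrix (Fin d) (Fin d) ℝ) (hJ : Jᵀ = -J)
    (g : EuclideanSpace ℝ (Fin d)) :
    ⟪g, Matrix.toEuclideanCLM (𝕜 := ℝ) (1 + J) g⟫ = ‖g‖ ^ 2 := by
  have h0 : ⟪g, Matrix.toEuclideanCLM (𝕜 := ℝ) J g⟫ = 0 := by
    rw [Matrix.inner_toEuclideanCLM]
    have : g.ofLp ⬝ᵥ J *ᵥ g.ofLp = - (g.ofLp ⬝ᵥ J *ᵥ g.ofLp) := by
      conv_lhs => rw [dotProduct_mulVec, ← mulVec_transpose, hJ, neg_mulVec, neg_dotProduct,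
        dotProduct_comm]
    linarith
  rw [map_add, map_one, _root_.add_apply, inner_add_right, h0]
  simp

lemma grad_lower {r g F m b M B A : ℝ} (hm : 0 < m) (hM : 0 < M) (hB : 0 < B)
    (h1 : m * r ^ 2 - b ≤ r * g) (h2 : F ≤ M / 2 * r ^ 2 + B * r + A) :
    2 * m ^ 2 / (M + B) * (F - B / 2 - A) - 2 * m * b ≤ g ^ 2 := by
  have h3 : F - B / 2 - A ≤ (M + B) / 2 * r ^ 2 := by nlinarith [sq_nonneg (r - 1)]
  have h4 : 2 * m ^ 2 / (M + B) * (F - B / 2 - A) ≤ 2 * m ^ 2 / (M + B) * ((M + B) / 2 * r ^ 2) :=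
    mul_le_mul_of_nonneg_left h3 (by positivity)
  have h5 : 2 * m ^ 2 / (M + B) * ((M + B) / 2 * r ^ 2) = m ^ 2 * r ^ 2 := by
    field_simp
  nlinarith [sq_nonneg (g - m * r), mul_le_mul_of_nonneg_left h1 hm.le]

lemma m_le_M {d : ℕ} (hd : d ≠ 0) (G : EuclideanSpace ℝ (Fin d) → EuclideanSpace ℝ (Fin d))
    {m b M : ℝ}
    (hlip : ∀ x y, ‖G x - G y‖ ≤ M * ‖x - y‖)
    (hdiss : ∀ x, ⟪x, G x⟫ ≥ m * ‖x‖ ^ 2 - b) : m ≤ M := by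
  by_contra! h
  have key : ∀ r : ℝ, 0 ≤ r → (m - M) * r ^ 2 ≤ ‖G 0‖ * r + b := by
    intro r hr
    set e : EuclideanSpace ℝ (Fin d) := EuclideanSpace.single ⟨0, Nat.pos_of_ne_zero hd⟩ r
    have he : ‖e‖ = r := by simp [e, abs_of_nonneg hr]
    have h1 := hdiss e
    have h2 := real_inner_le_norm e (G e)
    have h3 := hlip e 0
    have h4 : ‖G e‖ ≤ ‖G e - G 0‖ + ‖G 0‖ := by simpa using norm_add_le (G e - G 0) (G 0)
    rw [sub_zero] at h3
    rw [he] at h1 h2 h3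
    nlinarith [mul_le_mul_of_nonneg_left (h4.trans (add_le_add_left h3 _)) hr]
  have hp : 0 < m - M := sub_pos.2 h
  have hb0 := key 0 le_rfl
  have h1 := key ((‖G 0‖ + b + 1) / (m - M) + 1) (by simp at hb0; positivity)
  simp at hb0
  set s := (‖G 0‖ + b + 1) / (m - M) with hs
  have hs' : (m - M) * s = ‖G 0‖ + b + 1 := by rw [hs]; field_simp
  have hs0 : 0 ≤ s := by positivity
  nlinarith [norm_nonneg (G 0), mul_nonneg (norm_nonneg (G 0)) hs0, mul_nonneg hb0 hs0]

theorem nld_uniform_F_bound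
    {Ω : Type*} [MeasurableSpace Ω] (P : Measure Ω) [IsProbabilityMeasure P]
    {d : ℕ}
    (F : EuclideanSpace ℝ (Fin d) → ℝ) (hF : ContDiff ℝ 1 F)
    (hFnonneg : ∀ x, 0 ≤ F x)
    (m b M B A : ℝ)
    (hm : 0 < m) (hb : 0 < b) (hM : 0 < M) (hB : 0 < B) (hA : 0 < A)
    -- Lipschitz gradient
    (hlip : ∀ x y, ‖∇ F x - ∇ F y‖ ≤ M * ‖x - y‖)
    -- dissipativity
    (hdiss : ∀ x, ⟪x, ∇ F x⟫ ≥ m * ‖x‖ ^ 2 - b)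
    -- quadratic growth
    (hgrowth : ∀ x, F x ≤ M / 2 * ‖x‖ ^ 2 + B * ‖x‖ + A)
    -- J antisymmetric, A_J = I + J
    (J : Matrix (Fin d) (Fin d) ℝ) (hJ : Jᵀ = -J)
    (AJ : Matrix (Fin d) (Fin d) ℝ) (hAJ : AJ = 1 + J)
    (β η : ℝ) (hβ : 0 < β) (hη0 : 0 < η) (hη : η ≤ 1 / (M * specNorm AJ ^ 2))
    -- i.i.d. standard Gaussian noise
    (ξ : ℕ → Ω → EuclideanSpace ℝ (Fin d)) (hξmeas : ∀ k, Measurable (ξ k))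
    (hξindep : iIndepFun ξ P)
    (hξ : ∀ k, Measure.map (ξ k) P = stdGaussianE d)
    -- the NLD iterates
    (x : EuclideanSpace ℝ (Fin d))
    (X : ℕ → Ω → EuclideanSpace ℝ (Fin d))
    (hX0 : ∀ ω, X 0 ω = x)
    (hXrec : ∀ k ω, X (k + 1) ω =
      X k ω - η • (Matrix.toEuclideanCLM (𝕜 := ℝ) AJ) (∇ F (X k ω)) +
        Real.sqrt (2 * η * β⁻¹) • ξ k ω) :
    ∀ k : ℕ, (∫ ω, F (X k ω) ∂P) ≤
      F x + B / 2 + A + 4 * (M + B) * M * β⁻¹ * d / m ^ 2 + (M + B) * b / m := by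
  set T : EuclideanSpace ℝ (Fin d) →L[ℝ] EuclideanSpace ℝ (Fin d) :=
    Matrix.toEuclideanCLM (𝕜 := ℝ) AJ with hT
  set σ := Real.sqrt (2 * η * β⁻¹) with hσ
  have hσ2 : σ ^ 2 = 2 * η * β⁻¹ := Real.sq_sqrt (by positivity)
  have hTin : ∀ g, ⟪g, T g⟫ = ‖g‖ ^ 2 := by
    intro g; rw [hT, hAJ]; exact inner_AJ J hJ g
  change η ≤ 1 / (M * ‖T‖ ^ 2) at hη
  -- the dimension is positive
  have hd : d ≠ 0 := by
    rintro rfl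
    have h0 : ‖T‖ = 0 := by
      rw [norm_eq_zero]; exact Subsingleton.elim _ _
    rw [h0] at hη
    norm_num at hη
    linarith
  have hT1 : 1 ≤ ‖T‖ := by
    set e : EuclideanSpace ℝ (Fin d) := EuclideanSpace.single ⟨0, Nat.pos_of_ne_zero hd⟩ 1
    have he : ‖e‖ = 1 := by simp [e]
    have h1 := hTin e
    have h2 := real_inner_le_norm e (T e)
    have h3 := T.le_opNorm e
    rw [he] at h1 h2 h3
    linarith
  have hmM : m ≤ M := m_le_M hd (∇ F) hlip hdiss
  have hηT : M * η * ‖T‖ ^ 2 ≤ 1 := by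
    rw [le_div_iff₀ (by positivity)] at hη
    linarith
  have hηM : M * η ≤ 1 := by
    have h1 : (1 : ℝ) ≤ ‖T‖ ^ 2 := one_le_pow₀ hT1
    exact (le_mul_of_one_le_right (by positivity) h1).trans hηT
  set c := η * m ^ 2 / (M + B) with hc
  have hMB : 0 < M + B := by linarith
  have hc0 : 0 < c := by positivity
  have hc1 : c ≤ 1 := by
    rw [hc, div_le_one hMB]
    nlinarith [mul_le_mul_of_nonneg_left (mul_le_mul hmM hmM hm.le hM.le) hη0.le]
  -- continuity of the gradient
  have hlipW : LipschitzWith (Real.toNNReal M) (∇ F) := by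
    refine LipschitzWith.of_dist_le_mul fun y z => ?_
    rw [dist_eq_norm, dist_eq_norm, Real.coe_toNNReal _ hM.le]
    exact hlip y z
  have hGc : Continuous (∇ F) := hlipW.continuous
  have hGm : Measurable (∇ F) := hGc.measurable
  -- noise facts
  have hξL2 : ∀ k, MemLp (ξ k) 2 P := by
    intro k
    have h2 : MemLp id 2 (Measure.map (ξ k) P) := by
      rw [hξ k, stdGaussianE_eq]; exact IsGaussian.memLp_two_id
    exact (memLp_map_measure_iff h2.aestronglyMeasurable (hξmeas k).aemeasurable).1 h2
  have hξ0 : ∀ k, ∫ ω, ξ k ω ∂P = 0 := by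
    intro k
    have h := integral_map (μ := P) (hξmeas k).aemeasurable
      (f := fun y : EuclideanSpace ℝ (Fin d) => y) (by fun_prop)
    rw [← h, hξ k, stdGaussianE_eq]
    exact integral_id_stdGaussian
  have hξ2 : ∀ k, ∫ ω, ‖ξ k ω‖ ^ 2 ∂P = d := by
    intro k
    have h := integral_map (μ := P) (hξmeas k).aemeasurable
      (f := fun y : EuclideanSpace ℝ (Fin d) => ‖y‖ ^ 2) (by fun_prop)
    rw [← h, hξ k, stdGaussianE_eq]
    exact integral_norm_sq_stdGaussian d
  -- measurability of the iterates
  have hXmeas' : ∀ k, Measurable[⨆ j ∈ Set.Iio k, MeasurableSpace.comap (ξ j) inferInstance]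
      (X k) := by
    intro k
    induction k with
    | zero =>
      have : X 0 = fun _ => x := funext hX0
      rw [this]
      exact measurable_const
    | succ k ih =>
      have h1 : Measurable[⨆ j ∈ Set.Iio (k + 1), MeasurableSpace.comap (ξ j) inferInstance]
          (X k) := by
        refine ih.mono (biSup_mono fun j hj => ?_) le_rfl
        exact lt_trans hj (Nat.lt_succ_self k)
      have h2 : Measurable[⨆ j ∈ Set.Iio (k + 1), MeasurableSpace.comap (ξ j) inferInstance]
          (ξ k) := by
        refine (comap_measurable (ξ k)).mono ?_ le_rfl
        exact le_biSup (fun j => MeasurableSpace.comap (ξ j) inferInstance)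
          (Set.mem_Iio.2 (Nat.lt_succ_self k))
      have h3 : X (k + 1) = fun ω => X k ω - η • T (∇ F (X k ω)) + σ • ξ k ω :=
        funext (hXrec k)
      rw [h3]
      have hf : Measurable (fun y : EuclideanSpace ℝ (Fin d) => y - η • T (∇ F y)) := by fun_prop
      exact (hf.comp h1).add (h2.const_smul σ)
  have hle : ∀ j, MeasurableSpace.comap (ξ j) inferInstance ≤ ‹MeasurableSpace Ω› :=
    fun j => (hξmeas j).comap_le
  have hXmeas : ∀ k, Measurable (X k) := fun k =>
    (hXmeas' k).mono (iSup₂_le fun j _ => hle j) le_rfl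
  have hindep : ∀ k, IndepFun (X k) (ξ k) P := by
    intro k
    have h := indep_iSup_of_disjoint hle hξindep.iIndep (S := Set.Iio k) (T := {k}) (by simp)
    rw [IndepFun_iff_Indep]
    refine indep_of_indep_of_le_left (indep_of_indep_of_le_right h ?_) ?_
    · simp
    · exact (hXmeas' k).comap_le
  -- second moments
  have hGL2 : ∀ Y : Ω → EuclideanSpace ℝ (Fin d), MemLp Y 2 P → MemLp (fun ω => ∇ F (Y ω)) 2 P := by
    intro Y hY
    have h1 : MemLp (fun ω => M * ‖Y ω‖ + ‖∇ F 0‖) 2 P :=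
      (hY.norm.const_mul M).add (memLp_const _)
    refine h1.mono' (hGc.comp_aestronglyMeasurable hY.1) (ae_of_all _ fun ω => ?_)
    have h3 := hlip (Y ω) 0
    have h4 : ‖∇ F (Y ω)‖ ≤ ‖∇ F (Y ω) - ∇ F 0‖ + ‖∇ F 0‖ := by
      simpa only [sub_add_cancel] using norm_add_le (∇ F (Y ω) - ∇ F 0) (∇ F 0)
    rw [sub_zero] at h3
    linarith
  have hXL2 : ∀ k, MemLp (X k) 2 P := by
    intro k
    induction k with
    | zero =>
      have : X 0 = fun _ => x := funext hX0
      rw [this]; exact memLp_const _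
    | succ k ih =>
      have h3 : X (k + 1) = fun ω => X k ω - η • T (∇ F (X k ω)) + σ • ξ k ω :=
        funext (hXrec k)
      rw [h3]
      exact (ih.sub ((T.comp_memLp' (hGL2 _ ih)).const_smul η)).add ((hξL2 k).const_smul σ)
  have hFint : ∀ k, Integrable (fun ω => F (X k ω)) P := by
    intro k
    have h1 : Integrable (fun ω => M / 2 * ‖X k ω‖ ^ 2 + B * ‖X k ω‖ + A) P :=
      (((hXL2 k).integrable_norm_pow (by norm_num)).const_mul _ |>.add
        (((hXL2 k).integrable (by norm_num)).norm.const_mul _)).add (integrable_const _)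
    refine h1.mono' (hF.continuous.comp_aestronglyMeasurable (hXL2 k).1)
      (ae_of_all _ fun ω => ?_)
    rw [Real.norm_eq_abs, abs_of_nonneg (hFnonneg _)]
    exact hgrowth _
  -- one-step pointwise bound
  let h : EuclideanSpace ℝ (Fin d) → EuclideanSpace ℝ (Fin d) :=
    fun y => σ • ∇ F y - (M * η * σ) • T (∇ F y)
  have hhm : Measurable h := by fun_prop
  have hstep : ∀ k ω, F (X (k + 1) ω) ≤ (1 - c) * F (X k ω) + (c * (B / 2 + A) + η * m * b)
      + ⟪h (X k ω), ξ k ω⟫ + M * η * β⁻¹ * ‖ξ k ω‖ ^ 2 := by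
    intro k ω
    have hx : X (k + 1) ω = X k ω + (σ • ξ k ω - η • T (∇ F (X k ω))) := by
      rw [hXrec k ω]; abel
    have h1 := descent F hF M hlip (X k ω) (σ • ξ k ω - η • T (∇ F (X k ω)))
    rw [← hx] at h1
    set y := X k ω
    set g := ∇ F y with hg
    set z := ξ k ω
    have h2 : ⟪g, σ • z - η • T g⟫ = σ * ⟪g, z⟫ - η * ‖g‖ ^ 2 := by
      rw [inner_sub_right, inner_smul_right, inner_smul_right, hTin]
    have h3 : ‖σ • z - η • T g‖ ^ 2 =
        σ ^ 2 * ‖z‖ ^ 2 - 2 * (σ * η * ⟪T g, z⟫) + η ^ 2 * ‖T g‖ ^ 2 := by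
      rw [norm_sub_sq_real, inner_smul_left, inner_smul_right, norm_smul, norm_smul,
        real_inner_comm, mul_pow, mul_pow, Real.norm_eq_abs, Real.norm_eq_abs, sq_abs, sq_abs]
      simp
      ring
    have h4 : ⟪h y, z⟫ = σ * ⟪g, z⟫ - M * η * σ * ⟪T g, z⟫ := by
      simp only [h]
      rw [inner_sub_left, real_inner_smul_left, real_inner_smul_left]
    have h5 : ‖T g‖ ^ 2 ≤ ‖T‖ ^ 2 * ‖g‖ ^ 2 := by
      rw [← mul_pow]
      exact pow_le_pow_left₀ (norm_nonneg _) (T.le_opNorm g) 2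
    have h6 : M * η * ‖T g‖ ^ 2 ≤ ‖g‖ ^ 2 := by
      calc M * η * ‖T g‖ ^ 2 ≤ M * η * (‖T‖ ^ 2 * ‖g‖ ^ 2) :=
            mul_le_mul_of_nonneg_left h5 (by positivity)
        _ = (M * η * ‖T‖ ^ 2) * ‖g‖ ^ 2 := by ring
        _ ≤ 1 * ‖g‖ ^ 2 := mul_le_mul_of_nonneg_right hηT (by positivity)
        _ = ‖g‖ ^ 2 := one_mul _
    have h6' := mul_le_mul_of_nonneg_left h6 (half_pos hη0).le
    have h7 := grad_lower (r := ‖y‖) (g := ‖g‖) (F := F y) hm hM hB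
      ((hdiss y).le.trans (real_inner_le_norm _ _)) (hgrowth y)
    have h7' := mul_le_mul_of_nonneg_left h7 (half_pos hη0).le
    have h8 : η / 2 * (2 * m ^ 2 / (M + B) * (F y - B / 2 - A) - 2 * m * b) =
        c * (F y - B / 2 - A) - η * m * b := by
      rw [hc]; ring
    rw [h8] at h7'
    rw [h2, h3, hσ2] at h1
    rw [h4]
    linarith
  -- integrated step
  have hint : ∀ k, ∫ ω, F (X (k + 1) ω) ∂P ≤ (1 - c) * (∫ ω, F (X k ω) ∂P)
      + (c * (B / 2 + A) + η * m * b) + M * η * β⁻¹ * d := by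
    intro k
    have hhL2 : MemLp (fun ω => h (X k ω)) 2 P :=
      ((hGL2 _ (hXL2 k)).const_smul σ).sub
        ((T.comp_memLp' (hGL2 _ (hXL2 k))).const_smul (M * η * σ))
    have hi0 : Integrable (fun ω => ⟪h (X k ω), ξ k ω⟫) P := by
      have hn : Integrable (fun ω => ‖h (X k ω)‖ * ‖ξ k ω‖) P :=
        hhL2.norm.integrable_mul (hξL2 k).norm
      refine hn.mono' (hhL2.aestronglyMeasurable.inner (hξL2 k).1) (ae_of_all _ fun ω => ?_)
      exact norm_inner_le_norm _ _
    have hz : ∫ ω, ⟪h (X k ω), ξ k ω⟫ ∂P = 0 := by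
      have hh : IndepFun (fun ω => h (X k ω)) (ξ k) P :=
        (hindep k).comp hhm measurable_id
      have := hh.integral_bilin (hhL2.integrable (by norm_num))
        ((hξL2 k).integrable (by norm_num)) (innerSL ℝ)
      rw [hξ0 k, map_zero] at this
      exact this
    have hi1 : Integrable (fun ω => (1 - c) * F (X k ω)) P := (hFint k).const_mul _
    have hi2 : Integrable (fun ω => M * η * β⁻¹ * ‖ξ k ω‖ ^ 2) P :=
      ((hξL2 k).integrable_norm_pow (by norm_num)).const_mul _
    have hi3 : Integrable (fun _ : Ω => c * (B / 2 + A) + η * m * b) P := integrable_const _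
    have h1 := integral_mono (hFint (k + 1)) (((hi1.add hi3).add hi0).add hi2) (hstep k)
    refine h1.trans (le_of_eq ?_)
    rw [integral_add' ((hi1.add hi3).add hi0) hi2, integral_add' (hi1.add hi3) hi0,
      integral_add' hi1 hi3, hz, integral_const_mul, integral_const_mul, hξ2]
    simp
  set D := B / 2 + A + (M + B) * b / m + (M + B) * M * β⁻¹ * d / m ^ 2 with hD
  have hDc : c * D = c * (B / 2 + A) + η * m * b + M * η * β⁻¹ * d := by
    rw [hD, hc]; field_simp
  have hD0 : 0 ≤ D := by positivity
  have hFx := hFnonneg x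
  have hfin : ∀ k, ∫ ω, F (X k ω) ∂P ≤ F x + D := by
    intro k
    induction k with
    | zero => simp [hX0, hD0]
    | succ k ih =>
      have h1 := hint k
      have h2 := mul_le_mul_of_nonneg_left ih (sub_nonneg.2 hc1)
      nlinarith [mul_nonneg hc0.le hFx]
  intro k
  refine (hfin k).trans ?_
  have h1 : 4 * (M + B) * M * β⁻¹ * d / m ^ 2 = 4 * ((M + B) * M * β⁻¹ * d / m ^ 2) := by ring
  have h2 : 0 ≤ (M + B) * M * β⁻¹ * d / m ^ 2 := by positivity
  rw [h1, hD]
  linarith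

end
end
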